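/- arXiv:1905.13182 — 5 statements merged into one kernel-verified Lean document; each statement's English description precedes it below -/
import Mathlib

section
/- Let G be a connected finite graph with n vertices and m edges, and set f_G(t) = det(I_n − t·A(G) + t^2·Q). Then the derivative of f_G at t = 1 satisfies f_G′(1) = 2(m − n)·κ(G). -/
open Finset SimpleGraph

/-- The complexity `κ(G)`: the number of spanning trees of `G`. -/
noncomputable def numSpanningTrees {V : Type*} (G : SimpleGraph V) : ℕ :=
  Nat.card {T : SimpleGraph V // T ≤ G ∧ T.IsTree}

/-- parent functions directed to the root `r`. -/
def IsParent {V : Type*} (G : SimpleGraph V) (r : V) (p : V → V) : Prop :=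
  p r = r ∧ (∀ i, i ≠ r → G.Adj i (p i)) ∧ ∀ i, ∃ k, p^[k] i = r

/-- the tree of a parent function. -/
def parentTree {V : Type*} (p : V → V) : SimpleGraph V :=
  SimpleGraph.fromRel (fun i j => p i = j)

theorem parentTree_adj {V : Type*} (p : V → V) (i j : V) :
    (parentTree p).Adj i j ↔ i ≠ j ∧ (p i = j ∨ p j = i) := by
  simp [parentTree]

theorem parentTree_le {V : Type*} {G : SimpleGraph V} {r : V} {p : V → V}
    (h : IsParent G r p) : parentTree p ≤ G := by
  intro i j hij
  rw [parentTree_adj] at hij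
  obtain ⟨hne, h1 | h1⟩ := hij
  · have hi : i ≠ r := by rintro rfl; exact hne (h.1.symm.trans h1)
    rw [← h1]; exact h.2.1 i hi
  · have hj : j ≠ r := by rintro rfl; exact hne (h1.symm.trans h.1)
    rw [← h1]; exact (h.2.1 j hj).symm

theorem parentTree_reach {V : Type*} (p : V → V) (i : V) (k : ℕ) :
    (parentTree p).Reachable i (p^[k] i) := by
  induction k with
  | zero => exact Reachable.refl _
  | succ k ih =>
    rw [Function.iterate_succ_apply']
    by_cases hh : p^[k] i = p (p^[k] i)
    · rw [← hh]; exact ih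
    · exact ih.trans (SimpleGraph.Adj.reachable ((parentTree_adj _ _ _).2 ⟨hh, Or.inl rfl⟩))

theorem parentTree_connected {V : Type*} {G : SimpleGraph V} {r : V} {p : V → V}
    (h : IsParent G r p) : (parentTree p).Connected := by
  rw [connected_iff_exists_forall_reachable]
  refine ⟨r, fun w => ?_⟩
  obtain ⟨k, hk⟩ := h.2.2 w
  have := parentTree_reach p w k
  rw [hk] at this
  exact this.symm

theorem parentTree_isTree {V : Type*} [Finite V] {G : SimpleGraph V} {r : V} {p : V → V}
    (h : IsParent G r p) : (parentTree p).IsTree := by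
  classical
  have := Fintype.ofFinite V
  have hc := parentTree_connected h
  rw [isTree_iff_connected_and_card]
  refine ⟨hc, le_antisymm ?_ hc.card_vert_le_card_edgeSet_add_one⟩
  have hsub : (parentTree p).edgeFinset ⊆ (univ.erase r).image (fun i => s(i, p i)) := by
    intro e
    induction e with
    | _ i j =>
    intro he
    rw [mem_edgeFinset, mem_edgeSet, parentTree_adj] at he
    obtain ⟨hne, h1 | h1⟩ := he
    · have hi : i ≠ r := by rintro rfl; exact hne (h.1.symm.trans h1)
      exact mem_image.2 ⟨i, by simp [hi], by rw [h1]⟩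
    · have hj : j ≠ r := by rintro rfl; exact hne (h1.symm.trans h.1)
      exact mem_image.2 ⟨j, by simp [hj], by rw [h1, Sym2.eq_swap]⟩
  have h1 := (card_le_card hsub).trans card_image_le
  rw [card_erase_of_mem (mem_univ _), card_univ] at h1
  have h2 : 0 < Fintype.card V := Fintype.card_pos_iff.2 ⟨r⟩
  rw [Nat.card_eq_fintype_card, Nat.card_eq_fintype_card, ← edgeFinset_card]
  omega

theorem parentTree_inj {V : Type*} {G : SimpleGraph V} {r : V} {p q : V → V}
    (hp : IsParent G r p) (hq : IsParent G r q) (hpq : parentTree p = parentTree q) : p = q := by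
  have two : ∀ i, i ≠ r → p (p i) ≠ i := by
    intro i hi h2
    have hpr : p i ≠ r := by
      intro h3; rw [h3, hp.1] at h2; exact hi h2.symm
    obtain ⟨k, hk⟩ := hp.2.2 i
    have : ∀ k, p^[k] i ≠ r ∧ p^[k] (p i) ≠ r := by
      intro k
      induction k with
      | zero => exact ⟨hi, hpr⟩
      | succ k ih =>
        rw [Function.iterate_succ_apply, Function.iterate_succ_apply, h2]
        exact ⟨ih.2, ih.1⟩
    exact (this k).1 hk
  have step : ∀ i, p i ≠ q i → p (p i) ≠ q (p i) := by
    intro i hi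
    have hir : i ≠ r := by rintro rfl; exact hi (hp.1.trans hq.1.symm)
    have hadj : (parentTree q).Adj i (p i) := by
      rw [← hpq, parentTree_adj]
      exact ⟨(hp.2.1 i hir).ne, Or.inl rfl⟩
    rw [parentTree_adj] at hadj
    obtain ⟨_, h1 | h1⟩ := hadj
    · exact absurd h1.symm hi
    · rw [h1]; exact two i hir
  funext i
  by_contra hi
  have all : ∀ k, p (p^[k] i) ≠ q (p^[k] i) := by
    intro k
    induction k with
    | zero => exact hi
    | succ k ih => rw [Function.iterate_succ_apply']; exact step _ ih
  obtain ⟨k, hk⟩ := hp.2.2 i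
  have := all k
  rw [hk] at this
  exact this (hp.1.trans hq.1.symm)

theorem parentTree_surj {V : Type*} {G : SimpleGraph V} (r : V) {T : SimpleGraph V}
    (hT : T.IsTree) (hTG : T ≤ G) : ∃ p, IsParent G r p ∧ parentTree p = T := by
  classical
  have key : ∀ i, ∃ j, (i = r → j = r) ∧ (i ≠ r → T.Adj i j ∧ T.dist j r < T.dist i r) := by
    intro i
    by_cases hi : i = r
    · exact ⟨r, fun _ => rfl, fun h => absurd hi h⟩
    · obtain ⟨w, hw⟩ := hT.connected.exists_walk_length_eq_dist i r
      cases w with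
      | nil => exact absurd rfl hi
      | cons hadj w =>
        refine ⟨_, fun h => absurd h hi, fun _ => ⟨hadj, ?_⟩⟩
        have := SimpleGraph.dist_le w
        rw [Walk.length_cons] at hw
        omega
  choose p hp1 hp2 using key
  have hreach : ∀ d i, T.dist i r ≤ d → ∃ k, p^[k] i = r := by
    intro d
    induction d with
    | zero =>
      intro i hi
      exact ⟨0, (hT.connected.dist_eq_zero_iff).1 (Nat.le_zero.1 hi)⟩
    | succ d ih =>
      intro i hi
      by_cases hir : i = r
      · exact ⟨0, hir⟩
      · obtain ⟨k, hk⟩ := ih (p i) (by have := (hp2 i hir).2; omega)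
        exact ⟨k + 1, hk⟩
  have hPT : IsParent T r p :=
    ⟨hp1 r rfl, fun i hi => (hp2 i hi).1, fun i => hreach _ i le_rfl⟩
  refine ⟨p, ⟨hPT.1, fun i hi => hTG (hPT.2.1 i hi), hPT.2.2⟩, ?_⟩
  exact le_antisymm (parentTree_le hPT)
    ((isTree_iff_minimal_connected.1 hT).2 (parentTree_connected hPT) (parentTree_le hPT))

theorem card_parent {V : Type*} [Finite V] (G : SimpleGraph V) (r : V) :
    Nat.card {p : V → V // IsParent G r p} = numSpanningTrees G := by
  refine Nat.card_eq_of_bijective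
    (fun p => (⟨parentTree p.1, parentTree_le p.2, parentTree_isTree p.2⟩ :
      {T : SimpleGraph V // T ≤ G ∧ T.IsTree})) ⟨?_, ?_⟩
  · intro p q h
    exact Subtype.ext (parentTree_inj p.2 q.2 (congrArg Subtype.val h))
  · rintro ⟨T, hTG, hT⟩
    obtain ⟨p, hp, rfl⟩ := parentTree_surj r hT hTG
    exact ⟨⟨p, hp⟩, rfl⟩

/-- The rows `e_i - e_{p i}`, with `e_r` at the root. -/
def prow {V : Type*} [DecidableEq V] (r i j : V) : V → ℝ :=
  if i = r then Pi.single r 1 else Pi.single i 1 - Pi.single j 1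

theorem det_prow_one {V : Type*} [Fintype V] [DecidableEq V] (r : V) (p : V → V)
    (hr : p r = r) (h : ∀ i, ∃ k, p^[k] i = r) :
    Matrix.det (Matrix.of fun i => prow r i (p i)) = 1 := by
  set N : Matrix V V ℝ := Matrix.of fun i => if i = r then 0 else Pi.single (p i) 1 with hN
  have hM : (Matrix.of fun i => prow r i (p i)) = 1 - N := by
    ext i j
    by_cases hi : i = r
    · subst hi; simp [prow, hN, Matrix.one_apply, Pi.single_apply, eq_comm]
    · simp only [prow, hN, hi, if_false, Matrix.sub_apply, Matrix.of_apply, Pi.sub_apply,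
        Matrix.one_apply, Pi.single_apply]
      simp only [eq_comm]
  have hpow : ∀ k i j, (N ^ k) i j ≠ 0 → p^[k] i = j ∧ (0 < k → p^[k-1] i ≠ r) := by
    intro k
    induction k with
    | zero =>
      intro i j hij
      simp [Matrix.one_apply] at hij
      simp [hij]
    | succ k ih =>
      intro i j hij
      rw [pow_succ, Matrix.mul_apply] at hij
      obtain ⟨l, -, hl⟩ := exists_ne_zero_of_sum_ne_zero hij
      obtain ⟨h1, -⟩ := ih i l (left_ne_zero_of_mul hl)
      have h2 := right_ne_zero_of_mul hl
      rw [hN, Matrix.of_apply] at h2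
      by_cases hlr : l = r
      · simp [hlr] at h2
      · simp [hlr, Pi.single_apply] at h2
        rw [Function.iterate_succ_apply', h1]
        exact ⟨h2.symm, fun _ => by simpa [h1] using hlr⟩
  have stay : ∀ k, p^[k] r = r := fun k => Function.iterate_fixed hr k
  choose K hK using h
  have hnil : IsNilpotent N := by
    refine ⟨(∑ i, K i) + 1, ?_⟩
    ext i j
    by_contra hne
    have h2 := (hpow _ i j hne).2 (Nat.succ_pos _)
    apply h2
    have hle : K i ≤ ∑ i, K i := single_le_sum (f := K) (fun _ _ => Nat.zero_le _) (mem_univ i)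
    obtain ⟨c, hc⟩ := Nat.exists_eq_add_of_le' hle
    rw [Nat.add_sub_cancel, hc, Function.iterate_add_apply, hK, stay]
  have hch := (Matrix.isNilpotent_charpoly_sub_pow_of_isNilpotent hnil).eq_zero
  have hev := congrArg (Polynomial.eval 1) (sub_eq_zero.1 hch)
  rw [Matrix.eval_charpoly] at hev
  rw [hM]
  simpa using hev

theorem det_prow_zero {V : Type*} [Fintype V] [DecidableEq V] (r : V) (p : V → V)
    (h : ¬ ∀ i, ∃ k, p^[k] i = r) :
    Matrix.det (Matrix.of fun i => prow r i (p i)) = 0 := by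
  classical
  rw [← Matrix.exists_mulVec_eq_zero_iff]
  push Not at h
  obtain ⟨i0, hi0⟩ := h
  refine ⟨fun i => if ∃ k, p^[k] i = r then 0 else 1, ?_, ?_⟩
  · intro h0
    have := congrFun h0 i0
    simp [hi0] at this
  · funext i
    change prow r i (p i) ⬝ᵥ _ = 0
    by_cases hi : i = r
    · subst hi
      have : ∃ k, p^[k] i = i := ⟨0, rfl⟩
      simp [prow, this]
    · have : (∃ k, p^[k] i = r) ↔ ∃ k, p^[k] (p i) = r := by
        constructor
        · rintro ⟨k, hk⟩
          cases k with
          | zero => exact absurd hk hi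
          | succ k => exact ⟨k, hk⟩
        · rintro ⟨k, hk⟩; exact ⟨k + 1, hk⟩
      simp [prow, hi, sub_dotProduct, this]

theorem adj_lap_diag {V : Type*} [Fintype V] [DecidableEq V] (G : SimpleGraph V)
    [DecidableRel G.Adj] (r : V) :
    (G.lapMatrix ℝ).adjugate r r = numSpanningTrees G := by
  classical
  rw [Matrix.adjugate_apply]
  let A : V → Finset V := fun i => if i = r then {r} else G.neighborFinset i
  have hrow : (G.lapMatrix ℝ).updateRow r (Pi.single r 1)
      = fun i => ∑ j ∈ A i, prow r i j := by
    funext i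
    by_cases hi : i = r
    · subst hi; simp [A, prow]
    · rw [Matrix.updateRow_ne hi]
      funext j
      simp only [A, prow, hi, if_false]
      rw [sum_sub_distrib, sum_const, card_neighborFinset_eq_degree]
      simp [lapMatrix, degMatrix, Matrix.diagonal_apply, Pi.single_apply, adjMatrix_apply, eq_comm,
        Finset.sum_apply]
  rw [hrow]
  have := (Matrix.detRowAlternating (n := V) (R := ℝ)).toMultilinearMap.map_sum_finset
    (fun i j => prow r i j) A
  refine this.trans ?_
  have hdet : ∀ p ∈ Fintype.piFinset A,
      (Matrix.detRowAlternating (n := V) (R := ℝ)).toMultilinearMap (fun i => prow r i (p i))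
        = if IsParent G r p then 1 else 0 := by
    intro p hp
    rw [Fintype.mem_piFinset] at hp
    have hr : p r = r := by simpa [A] using hp r
    have ha : ∀ i, i ≠ r → G.Adj i (p i) := fun i hi => by simpa [A, hi] using hp i
    change Matrix.det (Matrix.of fun i => prow r i (p i)) = _
    by_cases hh : ∀ i, ∃ k, p^[k] i = r
    · rw [det_prow_one r p hr hh, if_pos ⟨hr, ha, hh⟩]
    · rw [det_prow_zero r p hh, if_neg (fun h => hh h.2.2)]
  rw [sum_congr rfl hdet, ← card_parent G r, Nat.card_eq_fintype_card, Fintype.card_subtype,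
    sum_boole]
  congr 2
  ext p
  simp only [mem_filter, mem_univ, true_and, and_iff_right_iff_imp, Fintype.mem_piFinset]
  intro hp i
  by_cases hi : i = r
  · subst hi; simp [A, hp.1]
  · simpa [A, hi] using hp.2.1 i hi

theorem adj_lap {V : Type*} [Fintype V] [DecidableEq V] (G : SimpleGraph V)
    [DecidableRel G.Adj] (hG : G.Connected) (i j : V) :
    (G.lapMatrix ℝ).adjugate i j = numSpanningTrees G := by
  have : Nonempty V := ⟨i⟩
  rw [← adj_lap_diag G j]
  have h := Matrix.mul_adjugate (G.lapMatrix ℝ)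
  rw [det_lapMatrix_eq_zero, zero_smul] at h
  have h2 : (G.lapMatrix ℝ).mulVec (fun k => (G.lapMatrix ℝ).adjugate k j) = 0 := by
    funext k
    exact congrFun (congrFun h k) j
  exact (lapMatrix_mulVec_eq_zero_iff_forall_reachable G).1 h2 i j (hG.preconnected i j)

theorem hasDerivAt_det {V : Type*} [Fintype V] [DecidableEq V] (M : ℂ → Matrix V V ℂ)
    (dM : Matrix V V ℂ) (x : ℂ) (h : ∀ i j, HasDerivAt (fun t => M t i j) (dM i j) x) :
    HasDerivAt (fun t => (M t).det) (∑ i, ∑ j, dM i j * (M x).adjugate j i) x := by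
  let F : ContinuousMultilinearMap ℂ (fun _ : V => V → ℂ) ℂ :=
    { (Matrix.detRowAlternating (n := V) (R := ℂ)).toMultilinearMap with
      cont := by
        change Continuous (fun m : V → V → ℂ => Matrix.det (Matrix.of m))
        exact Continuous.matrix_det continuous_id }
  have hM : HasDerivAt (fun t => (fun i => M t i : V → V → ℂ)) (fun i => dM i) x := by
    rw [hasDerivAt_pi]; intro i; rw [hasDerivAt_pi]; intro j; exact h i j
  have := (F.hasFDerivAt (fun i => M x i)).comp_hasDerivAt x hM
  refine this.congr_deriv ?_
  rw [ContinuousMultilinearMap.linearDeriv_apply]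
  refine sum_congr rfl fun i _ => ?_
  change Matrix.det ((M x).updateRow i (dM i)) = _
  rw [Matrix.det_eq_sum_mul_adjugate_row _ i]
  refine sum_congr rfl fun j _ => ?_
  rw [Matrix.adjugate_apply, Matrix.adjugate_apply, Matrix.updateRow_idem, Matrix.updateRow_self]

theorem stmt2 {n : ℕ} (G : SimpleGraph (Fin n)) [DecidableRel G.Adj]
    (hG : G.Connected) (m : ℕ) (hm : G.edgeFinset.card = m) :
    deriv (fun t : ℂ => Matrix.det
        ((1 : Matrix (Fin n) (Fin n) ℂ) - t • G.adjMatrix ℂ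
          + t ^ 2 • (Matrix.diagonal (fun i => (G.degree i : ℂ)) - 1))) 1
      = 2 * ((m : ℂ) - n) * (numSpanningTrees G : ℂ) := by
  have hL : ((1 : Matrix (Fin n) (Fin n) ℂ) - (1 : ℂ) • G.adjMatrix ℂ
          + (1 : ℂ) ^ 2 • (Matrix.diagonal (fun i => (G.degree i : ℂ)) - 1))
      = Complex.ofRealHom.mapMatrix (G.lapMatrix ℝ) := by
    ext i j
    by_cases hij : i = j <;> by_cases ha : G.Adj i j <;>
      simp [lapMatrix, degMatrix, hij, ha, Matrix.one_apply]
  have hadj : ∀ i j, (((1 : Matrix (Fin n) (Fin n) ℂ) - (1 : ℂ) • G.adjMatrix ℂ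
          + (1 : ℂ) ^ 2 • (Matrix.diagonal (fun i => (G.degree i : ℂ)) - 1))).adjugate i j
      = (numSpanningTrees G : ℂ) := by
    intro i j
    rw [hL, ← RingHom.map_adjugate]
    simp [adj_lap G hG]
  have hd := hasDerivAt_det (fun t : ℂ =>
      ((1 : Matrix (Fin n) (Fin n) ℂ) - t • G.adjMatrix ℂ
          + t ^ 2 • (Matrix.diagonal (fun i => (G.degree i : ℂ)) - 1)))
      ((2 : ℂ) • (Matrix.diagonal (fun i => (G.degree i : ℂ)) - 1) - G.adjMatrix ℂ : Matrix (Fin n) (Fin n) ℂ) 1 (by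
    intro i j
    simp only [Matrix.add_apply, Matrix.sub_apply, Matrix.smul_apply, smul_eq_mul]
    have h1 := (((hasDerivAt_id (1 : ℂ)).mul_const (G.adjMatrix ℂ i j)).const_sub
      ((1 : Matrix (Fin n) (Fin n) ℂ) i j)).add (((hasDerivAt_id (1 : ℂ)).pow 2).mul_const
        (Matrix.diagonal (fun i => (G.degree i : ℂ)) i j - (1 : Matrix (Fin n) (Fin n) ℂ) i j))
    refine h1.congr_deriv ?_
    simp
    ring)
  rw [hd.deriv]
  simp only [hadj, ← sum_mul]
  congr 1
  have hs : ∀ i, ∑ j, ((2 : ℂ) • (Matrix.diagonal (fun i => (G.degree i : ℂ)) - 1) - G.adjMatrix ℂ : Matrix (Fin n) (Fin n) ℂ) i j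
      = (G.degree i : ℂ) - 2 := by
    intro i
    simp only [Matrix.sub_apply, Matrix.smul_apply, smul_sub, sum_sub_distrib, ← smul_sum]
    simp [Matrix.diagonal_apply, Matrix.one_apply, adjMatrix_apply]
    have hc := G.card_neighborFinset_eq_degree i
    rw [neighborFinset_eq_filter] at hc
    rw [hc]
    ring
  simp only [hs, sum_sub_distrib]
  have := G.sum_degrees_eq_twice_card_edges
  rw [hm] at this
  rw [← Nat.cast_sum, this]
  simp
  ring
end

section
/- Let G be a connected finite graph with n vertices and m edges whose minimum degree is at least two, and set f_G(t) = det(I_n − t·A(G) + t^2·Q). Then the second derivative of f_G at t = 1 satisfies f_G″(1) = 2(Kf^z + 2mn − 2n^2 + n)·κ(G), where Kf^z = Σ_{1≤i<j≤n} (d_i − 2)(d_j − 2) r_{ij}. -/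
open Finset SimpleGraph

/-- The determinant of the matrix obtained from `L` by deleting the `i`-th and `j`-th rows
and columns. -/
noncomputable def detMinor2 {V : Type*} [Fintype V] [DecidableEq V] (L : Matrix V V ℂ) (i j : V) : ℂ :=
  Matrix.det (L.submatrix (fun k : {k : V // k ≠ i ∧ k ≠ j} => (k : V))
    (fun k : {k : V // k ≠ i ∧ k ≠ j} => (k : V)))

/-- `f` is a parent function towards the root `r`. -/
def GoodPar {V : Type*} (r : V) (f : V → V) : Prop :=
  ∃ h : V → ℕ, ∀ v, v ≠ r → h (f v) < h v

/-- rows of the matrix of a functional graph -/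
noncomputable def parRow {V : Type*} [DecidableEq V] (r : V) (v w : V) : V → ℂ :=
  if v = r then Pi.single r 1 else Pi.single v 1 - Pi.single w 1

lemma det_good {V : Type*} [Fintype V] [DecidableEq V] (r : V) (f : V → V) (hf : GoodPar r f) :
    Matrix.det (Matrix.of fun v => parRow r v (f v) : Matrix V V ℂ) = 1 := by
  obtain ⟨h, hh⟩ := hf
  have hbt : Matrix.BlockTriangular (Matrix.of fun v => parRow r v (f v) : Matrix V V ℂ)
      (fun v => OrderDual.toDual (h v)) := by
    intro i j hij
    have hij' : h i < h j := hij
    show parRow r i (f i) j = 0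
    have hne : i ≠ j := by rintro rfl; exact lt_irrefl _ hij'
    simp only [parRow]
    split_ifs with hr
    · subst hr
      rw [Pi.single_apply, if_neg hne.symm]
    · have h2 : f i ≠ j := by
        intro he
        have := hh i hr
        rw [he] at this
        omega
      rw [Pi.sub_apply, Pi.single_apply, Pi.single_apply, if_neg hne.symm, if_neg h2.symm, sub_zero]
  rw [hbt.det]
  apply Finset.prod_eq_one
  intro a _
  have : Matrix.toSquareBlock (Matrix.of fun v => parRow r v (f v) : Matrix V V ℂ)
      (fun v => OrderDual.toDual (h v)) a = 1 := by
    ext ⟨i, hi⟩ ⟨j, hj⟩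
    rw [Matrix.one_apply]
    simp only [Subtype.mk.injEq]
    show parRow r i (f i) j = _
    have hij : h i = h j := OrderDual.toDual.injective (hi.trans hj.symm)
    simp only [parRow]
    split_ifs with hr he he
    · subst hr; subst he; simp
    · subst hr; rw [Pi.single_apply, if_neg (Ne.symm he)]
    · subst he
      have := hh i hr
      have h2 : f i ≠ i := by intro h3; rw [h3] at this; omega
      rw [Pi.sub_apply, Pi.single_apply, Pi.single_apply, if_pos rfl, if_neg h2.symm, sub_zero]
    · have := hh i hr
      have h2 : f i ≠ j := by intro h3; rw [h3] at this; omega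
      rw [Pi.sub_apply, Pi.single_apply, Pi.single_apply, if_neg (Ne.symm he), if_neg h2.symm, sub_zero]
  rw [this, Matrix.det_one]

lemma det_bad {V : Type*} [Fintype V] [DecidableEq V] (r : V) (f : V → V) (hf : ¬ GoodPar r f) :
    Matrix.det (Matrix.of fun v => parRow r v (f v) : Matrix V V ℂ) = 0 := by
  classical
  have hU : ∃ u, ∀ k, f^[k] u ≠ r := by
    by_contra hc
    push Not at hc
    apply hf
    refine ⟨fun v => Nat.find (hc v), fun v hv => ?_⟩
    have h0 : Nat.find (hc v) ≠ 0 := by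
      intro h0
      have := Nat.find_spec (hc v)
      rw [h0] at this
      exact hv this
    obtain ⟨k, hk⟩ := Nat.exists_eq_succ_of_ne_zero h0
    have hs := Nat.find_spec (hc v)
    rw [hk, Function.iterate_succ_apply] at hs
    have : Nat.find (hc (f v)) ≤ k := Nat.find_min' _ hs
    show Nat.find (hc (f v)) < Nat.find (hc v)
    omega
  obtain ⟨u, hu⟩ := hU
  rw [← Matrix.exists_mulVec_eq_zero_iff]
  refine ⟨fun v => if ∀ k, f^[k] v ≠ r then 1 else 0, ?_, ?_⟩
  · intro h
    have := congrFun h u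
    rw [if_pos hu] at this
    exact one_ne_zero this
  · ext v
    show (parRow r v (f v)) ⬝ᵥ _ = 0
    simp only [parRow]
    split_ifs with hr
    · rw [single_dotProduct, if_neg, mul_zero]
      intro h
      exact h 0 rfl
    · rw [sub_dotProduct, single_dotProduct, single_dotProduct, sub_eq_zero]
      have : (∀ k, f^[k] v ≠ r) ↔ ∀ k, f^[k] (f v) ≠ r := by
        constructor
        · intro h k
          exact h (k+1)
        · intro h k
          cases k with
          | zero => exact hr
          | succ k => exact h k
      simp only [this]

/-- The graph of a parent function. -/
def parGraph {V : Type*} (r : V) (f : V → V) : SimpleGraph V :=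
  SimpleGraph.fromRel (fun u v => u ≠ r ∧ f u = v)

lemma parGraph_connected {V : Type*} (r : V) (f : V → V) (hf : GoodPar r f) :
    (parGraph r f).Connected := by
  obtain ⟨h, hh⟩ := hf
  have key : ∀ k v, h v = k → (parGraph r f).Reachable v r := by
    intro k
    induction k using Nat.strong_induction_on with
    | _ k ih =>
      intro v hv
      by_cases hr : v = r
      · subst hr; exact SimpleGraph.Reachable.refl _
      · have h1 := hh v hr
        have h2 := ih (h (f v)) (by omega) (f v) rfl
        refine SimpleGraph.Reachable.trans (SimpleGraph.Adj.reachable ?_) h2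
        rw [parGraph, SimpleGraph.fromRel_adj]
        refine ⟨?_, Or.inl ⟨hr, rfl⟩⟩
        intro h3
        rw [← h3] at h1
        omega
  have : Nonempty V := ⟨r⟩
  exact SimpleGraph.Connected.mk (fun u v => (key _ u rfl).trans (key _ v rfl).symm)

lemma parGraph_isTree {V : Type*} [Fintype V] [DecidableEq V] (r : V) (f : V → V)
    (hf : GoodPar r f) : (parGraph r f).IsTree := by
  have hc := parGraph_connected r f hf
  rw [SimpleGraph.isTree_iff_connected_and_card]
  refine ⟨hc, le_antisymm ?_ hc.card_vert_le_card_edgeSet_add_one⟩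
  have hsub : (parGraph r f).edgeSet ⊆
      ((Finset.univ.erase r).image (fun v => s(v, f v)) : Finset (Sym2 V)) := by
    intro e
    induction e with
    | _ a b =>
      intro he
      rw [SimpleGraph.mem_edgeSet, parGraph, SimpleGraph.fromRel_adj] at he
      rw [Finset.mem_coe, Finset.mem_image]
      rcases he with ⟨_, ⟨h1, h2⟩ | ⟨h1, h2⟩⟩
      · exact ⟨a, by simp [h1], by rw [h2]⟩
      · exact ⟨b, by simp [h1], by rw [h2, Sym2.eq_swap]⟩
  have h1 := Set.ncard_le_ncard hsub (Finset.finite_toSet _)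
  rw [Set.ncard_coe_finset] at h1
  have h2 := h1.trans Finset.card_image_le
  rw [Finset.card_erase_of_mem (Finset.mem_univ r), Finset.card_univ] at h2
  have h3 : 0 < Fintype.card V := Fintype.card_pos_iff.mpr ⟨r⟩
  rw [Nat.card_eq_fintype_card (α := V)]
  have h4 : Nat.card (parGraph r f).edgeSet = (parGraph r f).edgeSet.ncard := rfl
  omega

lemma parGraph_inj {V : Type*} (r : V) (f g : V → V)
    (hf : GoodPar r f) (hfg : parGraph r f = parGraph r g) (v : V) (hv : v ≠ r) : f v = g v := by
  obtain ⟨h, hh⟩ := hf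
  have key : ∀ k v, h v = k → v ≠ r → f v = g v := by
    intro k
    induction k using Nat.strong_induction_on with
    | _ k ih =>
      intro v hv hr
      have h1 := hh v hr
      have hne : v ≠ f v := by
        intro h3
        rw [← h3] at h1
        omega
      have hadj : (parGraph r f).Adj v (f v) := by
        rw [parGraph, SimpleGraph.fromRel_adj]
        exact ⟨hne, Or.inl ⟨hr, rfl⟩⟩
      rw [hfg, parGraph, SimpleGraph.fromRel_adj] at hadj
      rcases hadj with ⟨_, ⟨_, h2⟩ | ⟨h2, h3⟩⟩
      · exact h2.symm
      · have h4 := ih (h (f v)) (by omega) (f v) rfl h2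
        have h5 := hh (f v) h2
        rw [h4, h3] at h5
        omega
  exact key _ v rfl hv

lemma exists_par {V : Type*} (r : V) (T : SimpleGraph V) (hT : T.Connected) :
    ∃ f : V → V, f r = r ∧ (∀ v, v ≠ r → T.Adj v (f v)) ∧ GoodPar r f := by
  classical
  have : ∀ v, ∃ w, (v = r → w = r) ∧ (v ≠ r → T.Adj v w ∧ T.dist w r < T.dist v r) := by
    intro v
    by_cases hv : v = r
    · exact ⟨r, fun _ => rfl, fun h => absurd hv h⟩
    · obtain ⟨p, hp⟩ := hT.exists_walk_length_eq_dist v r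
      cases p with
      | nil => exact absurd rfl hv
      | @cons _ w _ hadj q =>
        refine ⟨w, fun h => absurd h hv, fun _ => ⟨hadj, ?_⟩⟩
        have := SimpleGraph.dist_le q
        rw [SimpleGraph.Walk.length_cons] at hp
        omega
  choose f hf using this
  exact ⟨f, (hf r).1 rfl, fun v hv => ((hf v).2 hv).1, fun v => T.dist v r, fun v hv => ((hf v).2 hv).2⟩

lemma parGraph_le {V : Type*} (r : V) (T : SimpleGraph V) (f : V → V)
    (h : ∀ v, v ≠ r → T.Adj v (f v)) : parGraph r f ≤ T := by
  intro a b hab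
  rw [parGraph, SimpleGraph.fromRel_adj] at hab
  rcases hab with ⟨_, ⟨h1, h2⟩ | ⟨h1, h2⟩⟩
  · rw [← h2]; exact h a h1
  · rw [← h2]; exact (h b h1).symm

/-- allowed parents -/
def parSet {V : Type*} [Fintype V] [DecidableEq V] (G : SimpleGraph V) [DecidableRel G.Adj]
    (r v : V) : Finset V := if v = r then {r} else G.neighborFinset v

lemma mem_parSet {V : Type*} [Fintype V] [DecidableEq V] (G : SimpleGraph V) [DecidableRel G.Adj]
    (r : V) (f : V → V) : f ∈ Fintype.piFinset (parSet G r) ↔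
      f r = r ∧ ∀ v, v ≠ r → G.Adj v (f v) := by
  rw [Fintype.mem_piFinset]
  constructor
  · intro h
    refine ⟨by simpa [parSet] using h r, fun v hv => by simpa [parSet, hv] using h v⟩
  · rintro ⟨h1, h2⟩ v
    by_cases hv : v = r
    · subst hv; simp [parSet, h1]
    · simpa [parSet, hv] using h2 v hv

open Classical in
lemma card_good {V : Type*} [Fintype V] [DecidableEq V] (G : SimpleGraph V) [DecidableRel G.Adj]
    (r : V) : ((Fintype.piFinset (parSet G r)).filter (GoodPar r)).card = numSpanningTrees G := by
  rw [numSpanningTrees, ← Fintype.card_coe, ← Nat.card_eq_fintype_card]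
  refine Nat.card_congr (Equiv.ofBijective (fun f => ⟨parGraph r f.1, ?_, ?_⟩) ⟨?_, ?_⟩)
  · have h := (Finset.mem_filter.mp f.2).1
    rw [mem_parSet] at h
    exact parGraph_le r G f.1 h.2
  · exact parGraph_isTree r f.1 (Finset.mem_filter.mp f.2).2
  · rintro ⟨f, hf⟩ ⟨g, hg⟩ hfg
    rw [Finset.mem_filter, mem_parSet] at hf hg
    have hfg' : parGraph r f = parGraph r g := congrArg Subtype.val hfg
    apply Subtype.ext
    funext v
    by_cases hv : v = r
    · subst hv
      exact hf.1.1.trans hg.1.1.symm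
    · exact parGraph_inj r f g hf.2 hfg' v hv
  · rintro ⟨T, hTG, hT⟩
    obtain ⟨f, h1, h2, h3⟩ := exists_par r T hT.1
    refine ⟨⟨f, ?_⟩, ?_⟩
    · rw [Finset.mem_filter, mem_parSet]
      exact ⟨⟨h1, fun v hv => hTG (h2 v hv)⟩, h3⟩
    · apply Subtype.ext
      have hmin := SimpleGraph.isTree_iff_minimal_connected.mp hT
      exact le_antisymm (parGraph_le r T f h2)
        (hmin.2 (parGraph_connected r f h3) (parGraph_le r T f h2))

/-- `L` with the rows in `U` replaced by rows of the identity. -/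
noncomputable def pieceMat {V R : Type*} [CommRing R] [DecidableEq V] (U : Finset V)
    (L : Matrix V V R) : Matrix V V R :=
  Matrix.of fun v w => if v ∈ U then (1 : Matrix V V R) v w else L v w

lemma matrix_tree {V : Type*} [Fintype V] [DecidableEq V] (G : SimpleGraph V) [DecidableRel G.Adj]
    (r : V) :
    Matrix.det (pieceMat ({r} : Finset V)
      (Matrix.diagonal (fun k => (G.degree k : ℂ)) - G.adjMatrix ℂ)) = (numSpanningTrees G : ℂ) := by
  classical
  have h1 : pieceMat ({r} : Finset V)
      (Matrix.diagonal (fun k => (G.degree k : ℂ)) - G.adjMatrix ℂ) =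
      Matrix.of fun v => ∑ w ∈ parSet G r v, parRow r v w := by
    ext v w
    rw [pieceMat, Matrix.of_apply, Matrix.of_apply]
    by_cases hv : v = r
    · subst hv
      simp [parSet, parRow, Matrix.one_apply, Pi.single_apply, eq_comm]
    · rw [if_neg (by simpa using hv)]
      simp only [parSet, parRow, if_neg hv, Finset.sum_sub_distrib, Pi.sub_apply, Finset.sum_apply,
        Finset.sum_const, Finset.sum_apply, Pi.single_apply, Matrix.sub_apply, Matrix.diagonal_apply,
        SimpleGraph.adjMatrix_apply, Finset.sum_ite_eq, SimpleGraph.mem_neighborFinset,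
        SimpleGraph.card_neighborFinset_eq_degree]
      by_cases hw : v = w
      · subst hw; simp
      · simp [hw, Ne.symm hw]
  rw [h1]
  have h2 := (Matrix.detRowAlternating (R := ℂ) (n := V)).toMultilinearMap.map_sum_finset
    (fun v w => parRow r v w) (parSet G r)
  refine h2.trans ?_
  rw [← card_good G r, Finset.card_filter, Nat.cast_sum]
  apply Finset.sum_congr rfl
  intro f _
  split_ifs with hg
  · rw [Nat.cast_one]; exact det_good r f hg
  · rw [Nat.cast_zero]; exact det_bad r f hg

lemma det_expand {V R : Type*} [Fintype V] [DecidableEq V] [CommRing R] (L : Matrix V V R) (c : R)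
    (y : V → R) :
    Matrix.det (Matrix.diagonal y + c • L) =
      ∑ U : Finset V, (∏ i ∈ U, y i) * c ^ (Fintype.card V - U.card) * Matrix.det (pieceMat U L) := by
  have h := (Matrix.detRowAlternating (R := R) (n := V)).toMultilinearMap.map_add_univ
    (fun i => Matrix.diagonal y i) (fun i => c • L i)
  refine (Eq.trans ?_ h).trans ?_
  · rfl
  apply Finset.sum_congr rfl
  intro U _
  have h2 := (Matrix.detRowAlternating (R := R) (n := V)).toMultilinearMap.map_smul_univ
    (fun i => if i ∈ U then y i else c) (fun i => pieceMat U L i)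
  have h3 : (U.piecewise (fun i => Matrix.diagonal y i) (fun i => c • L i)) =
      fun i => (if i ∈ U then y i else c) • pieceMat U L i := by
    funext i j
    by_cases hi : i ∈ U
    · simp [hi, pieceMat, Matrix.one_apply, Matrix.diagonal_apply]
    · simp [hi, pieceMat]
  rw [h3, h2, smul_eq_mul]
  have h4 : (∏ i, if i ∈ U then y i else c) = (∏ i ∈ U, y i) * c ^ (Fintype.card V - U.card) := by
    rw [Finset.prod_ite]
    have e1 : Finset.univ.filter (fun i => i ∈ U) = U := by ext; simp
    have e2 : Finset.univ.filter (fun i => ¬ i ∈ U) = Uᶜ := by ext; simp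
    rw [e1, e2, Finset.prod_const, Finset.card_compl]
  rw [h4]
  rfl

lemma pieceMat_map {V R S : Type*} [Fintype V] [DecidableEq V] [CommRing R] [CommRing S]
    (φ : R →+* S) (U : Finset V) (L : Matrix V V R) :
    Matrix.det (pieceMat U (L.map φ)) = φ (Matrix.det (pieceMat U L)) := by
  rw [RingHom.map_det]
  congr 1
  ext i j
  simp only [pieceMat, Matrix.of_apply, RingHom.mapMatrix_apply, Matrix.map_apply]
  split_ifs
  · rw [Matrix.one_apply, Matrix.one_apply]; split_ifs <;> simp
  · rfl

lemma det_pieceMat_pair {V : Type*} [Fintype V] [DecidableEq V] (L : Matrix V V ℂ) (a b : V) :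
    Matrix.det (pieceMat {a, b} L) = detMinor2 L a b := by
  rw [Matrix.twoBlockTriangular_det _ (fun k => k ≠ a ∧ k ≠ b)]
  · have h1 : (pieceMat {a, b} L).toSquareBlockProp (fun k => ¬ (k ≠ a ∧ k ≠ b)) = 1 := by
      ext ⟨i, hi⟩ ⟨j, hj⟩
      have hi' : i ∈ ({a, b} : Finset V) := by
        simp only [Finset.mem_insert, Finset.mem_singleton]; tauto
      show (if i ∈ ({a, b} : Finset V) then (1 : Matrix V V ℂ) i j else L i j) = _
      rw [if_pos hi', Matrix.one_apply, Matrix.one_apply]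
      simp only [Subtype.mk.injEq]
    rw [h1, Matrix.det_one, mul_one, detMinor2]
    congr 1
    ext ⟨i, hi⟩ ⟨j, hj⟩
    have hi' : i ∉ ({a, b} : Finset V) := by
      simp only [Finset.mem_insert, Finset.mem_singleton]; tauto
    show (if i ∈ ({a, b} : Finset V) then (1 : Matrix V V ℂ) i j else L i j) = L i j
    rw [if_neg hi']
  · intro i hi j hj
    have hi' : i ∈ ({a, b} : Finset V) := by
      simp only [Finset.mem_insert, Finset.mem_singleton]; tauto
    have hne : i ≠ j := by rintro rfl; exact hi hj
    show (if i ∈ ({a, b} : Finset V) then (1 : Matrix V V ℂ) i j else L i j) = _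
    rw [if_pos hi', Matrix.one_apply_ne hne]

lemma det_pieceMat_empty {V : Type*} [Fintype V] [DecidableEq V] [Nonempty V] (G : SimpleGraph V)
    [DecidableRel G.Adj] :
    Matrix.det (pieceMat ∅ (Matrix.diagonal (fun k => (G.degree k : ℂ)) - G.adjMatrix ℂ)) = 0 := by
  rw [← Matrix.exists_mulVec_eq_zero_iff]
  refine ⟨fun _ => 1, ?_, ?_⟩
  · intro h
    exact one_ne_zero (congrFun h (Classical.arbitrary V))
  · have : pieceMat ∅ (Matrix.diagonal (fun k => (G.degree k : ℂ)) - G.adjMatrix ℂ)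
        = Matrix.diagonal (fun k => (G.degree k : ℂ)) - G.adjMatrix ℂ := by
      ext i j; simp [pieceMat]
    rw [this]
    exact SimpleGraph.lapMatrix_mulVec_const_eq_zero (R := ℂ) (G := G)

lemma sum_pairs {n : ℕ} (F : Finset (Fin n) → ℂ) :
    ∑ U ∈ Finset.powersetCard 2 (Finset.univ : Finset (Fin n)), F U =
      ∑ i : Fin n, ∑ j ∈ Finset.Ioi i, F {i, j} := by
  rw [Finset.sum_sigma']
  symm
  refine Finset.sum_bij (fun x _ => {x.1, x.2}) ?_ ?_ ?_ ?_
  · rintro ⟨i, j⟩ h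
    simp only [Finset.mem_sigma, Finset.mem_univ, true_and, Finset.mem_Ioi] at h
    rw [Finset.mem_powersetCard]
    exact ⟨Finset.subset_univ _, Finset.card_pair h.ne⟩
  · rintro ⟨i, j⟩ h ⟨i', j'⟩ h' he
    simp only [Finset.mem_sigma, Finset.mem_univ, true_and, Finset.mem_Ioi] at h h'
    simp only at he
    have a1 : i ∈ ({i', j'} : Finset (Fin n)) := by rw [← he]; simp
    have a2 : j ∈ ({i', j'} : Finset (Fin n)) := by rw [← he]; simp
    simp only [Finset.mem_insert, Finset.mem_singleton] at a1 a2
    have : i = i' ∧ j = j' := by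
      rcases a1 with rfl | rfl <;> rcases a2 with rfl | rfl <;> first | exact ⟨rfl, rfl⟩ | (exfalso; omega)
    obtain ⟨rfl, rfl⟩ := this
    rfl
  · intro U hU
    rw [Finset.mem_powersetCard] at hU
    obtain ⟨a, b, hab, rfl⟩ := Finset.card_eq_two.mp hU.2
    rcases lt_or_gt_of_ne hab with h | h
    · exact ⟨⟨a, b⟩, by simpa using h, rfl⟩
    · exact ⟨⟨b, a⟩, by simpa using h, Finset.pair_comm _ _⟩
  · intros; rfl

open Polynomial in
lemma coeff_two_expand {n : ℕ} (hn : 2 ≤ n) (L : Matrix (Fin n) (Fin n) ℂ) (a b : Fin n → ℂ) :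
    (Matrix.det (Matrix.diagonal (fun i => X * (C (a i) + X * C (b i))) +
      (1 + X : ℂ[X]) • L.map C)).coeff 2 =
    ((n : ℂ) * (n - 1) / 2) * Matrix.det (pieceMat ∅ L)
    + ∑ i, (b i + (n - 1) * a i) * Matrix.det (pieceMat {i} L)
    + ∑ i, ∑ j ∈ Finset.Ioi i, a i * a j * Matrix.det (pieceMat {i, j} L) := by
  rw [det_expand, Polynomial.finsetSum_coeff]
  obtain ⟨F, hF'⟩ : ∃ F : Finset (Fin n) → ℂ, ∀ U, F U =
      (X ^ U.card * ((∏ i ∈ U, (C (a i) + X * C (b i))) *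
      (1 + X : ℂ[X]) ^ (n - U.card))).coeff 2 * Matrix.det (pieceMat U L) := ⟨_, fun _ => rfl⟩
  have hF : ∀ U ∈ (Finset.univ : Finset (Finset (Fin n))),
      ((∏ i ∈ U, (X * (C (a i) + X * C (b i)))) * (1 + X : ℂ[X]) ^ (Fintype.card (Fin n) - U.card) *
        Matrix.det (pieceMat U (L.map C))).coeff 2 = F U := by
    intro U _
    rw [hF', pieceMat_map, Polynomial.coeff_mul_C, Finset.prod_mul_distrib, Finset.prod_const,
      Fintype.card_fin, mul_assoc]
  rw [Finset.sum_congr rfl hF]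
  rw [← Finset.powerset_univ, Finset.sum_powerset, Finset.card_univ, Fintype.card_fin]
  have hsub : Finset.range 3 ⊆ Finset.range (n + 1) := by
    intro x; simp only [Finset.mem_range]; omega
  rw [← Finset.sum_subset hsub]
  · rw [Finset.sum_range_succ, Finset.sum_range_succ, Finset.sum_range_one,
      Finset.powersetCard_zero, Finset.sum_singleton, Finset.powersetCard_one, Finset.sum_map, sum_pairs]
    congr 1
    · congr 1
      · rw [hF']
        congr 1
        simp only [Finset.card_empty, Finset.prod_empty, pow_zero, one_mul, Nat.sub_zero]
        rw [Polynomial.coeff_one_add_X_pow, Nat.cast_choose_two]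
      · apply Finset.sum_congr rfl
        intro i _
        show F {i} = _
        rw [hF']
        congr 1
        simp only [Finset.card_singleton, Finset.prod_singleton, pow_one]
        rw [Polynomial.coeff_X_mul, add_mul, Polynomial.coeff_add, Polynomial.coeff_C_mul, mul_assoc,
          Polynomial.coeff_X_mul, Polynomial.coeff_C_mul, Polynomial.coeff_one_add_X_pow,
          Polynomial.coeff_one_add_X_pow, Nat.choose_one_right, Nat.choose_zero_right,
          Nat.cast_sub (by omega)]
        push_cast
        ring
    · apply Finset.sum_congr rfl
      intro i _
      apply Finset.sum_congr rfl
      intro j hj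
      rw [hF', Finset.card_pair (Finset.mem_Ioi.mp hj).ne, Finset.prod_pair (Finset.mem_Ioi.mp hj).ne]
      congr 1
      rw [Polynomial.coeff_X_pow_mul', if_pos le_rfl, Nat.sub_self, Polynomial.coeff_zero_eq_eval_zero]
      simp
  · intro k _ hk
    rw [Finset.mem_range] at hk
    apply Finset.sum_eq_zero
    intro U hU
    rw [Finset.mem_powersetCard] at hU
    show F U = 0
    rw [hF', Polynomial.coeff_X_pow_mul', if_neg (by omega), zero_mul]

open Polynomial in
lemma deriv2_eval (p : ℂ[X]) :
    deriv (deriv (fun t : ℂ => p.eval (t - 1))) 1 = 2 * p.coeff 2 := by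
  have h1 : ∀ q : ℂ[X], deriv (fun t : ℂ => q.eval (t - 1)) = fun t => q.derivative.eval (t - 1) := by
    intro q
    funext t
    rw [deriv_comp_sub_const (f := fun x => q.eval x), Polynomial.deriv]
  rw [h1, h1]
  show (derivative (derivative p)).eval (1 - 1) = _
  rw [sub_self, ← Polynomial.coeff_zero_eq_eval_zero, Polynomial.coeff_derivative,
    Polynomial.coeff_derivative]
  norm_num
  ring

theorem stmt3 {n : ℕ} (G : SimpleGraph (Fin n)) [DecidableRel G.Adj]
    (hG : G.Connected) (m : ℕ) (hm : G.edgeFinset.card = m)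
    (hδ : ∀ v, 2 ≤ G.degree v) :
    deriv (deriv (fun t : ℂ => Matrix.det
        ((1 : Matrix (Fin n) (Fin n) ℂ) - t • G.adjMatrix ℂ
          + t ^ 2 • (Matrix.diagonal (fun i => (G.degree i : ℂ)) - 1)))) 1
      = 2 * ((∑ i : Fin n, ∑ j ∈ Finset.Ioi i,
            ((G.degree i : ℂ) - 2) * ((G.degree j : ℂ) - 2) *
              (detMinor2 (Matrix.diagonal (fun k => (G.degree k : ℂ)) - G.adjMatrix ℂ) i j
                / (numSpanningTrees G : ℂ)))
          + 2 * m * n - 2 * (n : ℂ) ^ 2 + n) * (numSpanningTrees G : ℂ) := by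
  have hne : Nonempty (Fin n) := hG.nonempty
  obtain ⟨v0⟩ := hne
  have hn : 2 ≤ n := by
    have h1 := hδ v0
    have h2 := G.degree_lt_card_verts v0
    rw [Fintype.card_fin] at h2
    omega
  have hκ : (numSpanningTrees G : ℂ) ≠ 0 := by
    rw [Nat.cast_ne_zero, numSpanningTrees]
    obtain ⟨T, hT, hT'⟩ := hG.exists_isTree_le
    have : Nonempty {T : SimpleGraph (Fin n) // T ≤ G ∧ T.IsTree} := ⟨⟨T, hT, hT'⟩⟩
    exact Nat.card_pos.ne'
  have hfun : (fun t : ℂ => Matrix.det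
        ((1 : Matrix (Fin n) (Fin n) ℂ) - t • G.adjMatrix ℂ
          + t ^ 2 • (Matrix.diagonal (fun i => (G.degree i : ℂ)) - 1))) =
      fun t => (Matrix.det (Matrix.diagonal (fun i => Polynomial.X *
        (Polynomial.C ((G.degree i : ℂ) - 2) + Polynomial.X * Polynomial.C ((G.degree i : ℂ) - 1))) +
      (1 + Polynomial.X : Polynomial ℂ) •
        (Matrix.diagonal (fun k => (G.degree k : ℂ)) - G.adjMatrix ℂ).map Polynomial.C)).eval (t - 1) := by
    funext t
    rw [← Polynomial.coe_evalRingHom, RingHom.map_det]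
    congr 1
    ext i j
    simp only [RingHom.mapMatrix_apply, Matrix.map_apply, Matrix.add_apply, Matrix.sub_apply,
      Matrix.smul_apply, Matrix.diagonal_apply, Matrix.one_apply, smul_eq_mul,
      Polynomial.coe_evalRingHom]
    by_cases hij : i = j
    · subst hij
      simp
      ring
    · by_cases ha : G.Adj i j
      · simp [hij, ha]
        ring
      · simp [hij, ha]
  have hne : Nonempty (Fin n) := ⟨v0⟩
  rw [hfun, deriv2_eval, coeff_two_expand hn, det_pieceMat_empty]
  simp only [matrix_tree, det_pieceMat_pair]
  have hdeg : ∑ i, (G.degree i : ℂ) = 2 * m := by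
    rw [← hm]
    exact_mod_cast G.sum_degrees_eq_twice_card_edges
  have h1 : ∑ i : Fin n, ((G.degree i : ℂ) - 1 + (n - 1) * ((G.degree i : ℂ) - 2)) *
      (numSpanningTrees G : ℂ) = (2 * m * n - 2 * (n : ℂ) ^ 2 + n) * numSpanningTrees G := by
    rw [← Finset.sum_mul, Finset.sum_add_distrib, ← Finset.mul_sum, Finset.sum_sub_distrib,
      Finset.sum_sub_distrib, hdeg]
    simp only [Finset.sum_const, Finset.card_univ, Fintype.card_fin, nsmul_eq_mul]
    ring
  rw [h1]
  have h2 : ∑ i : Fin n, ∑ j ∈ Finset.Ioi i, ((G.degree i : ℂ) - 2) * ((G.degree j : ℂ) - 2) *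
        detMinor2 (Matrix.diagonal (fun k => (G.degree k : ℂ)) - G.adjMatrix ℂ) i j =
      (∑ i : Fin n, ∑ j ∈ Finset.Ioi i, ((G.degree i : ℂ) - 2) * ((G.degree j : ℂ) - 2) *
        (detMinor2 (Matrix.diagonal (fun k => (G.degree k : ℂ)) - G.adjMatrix ℂ) i j
                / (numSpanningTrees G : ℂ))) * numSpanningTrees G := by
    rw [Finset.sum_mul]
    apply Finset.sum_congr rfl
    intro i _
    rw [Finset.sum_mul]
    apply Finset.sum_congr rfl
    intro j _
    rw [mul_assoc _ (_ / _), div_mul_cancel₀ _ hκ]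
  rw [h2]
  ring
end

section
/- Let G be a connected finite graph with n vertices and m edges, and set F(u,t) = det(I_n − t·A(G) + (1−u)t^2(D − (1−u)I_n)). Then the partial derivatives of F, evaluated at u = 1 − 1/t, satisfy ∂F/∂t |_{(1−1/t, t)} = 2 t^{n−2}(mt − n)·κ(G) and ∂F/∂u |_{(1−1/t, t)} = −2 t^{n}(mt − n)·κ(G), as identities of rational functions in t. -/
open Finset SimpleGraph

/-- The two-variable function F(u,t) of Li and Hou. -/
noncomputable def FLH {n : ℕ} (G : SimpleGraph (Fin n)) [DecidableRel G.Adj] (u t : ℂ) : ℂ :=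
  Matrix.det ((1 : Matrix (Fin n) (Fin n) ℂ) - t • G.adjMatrix ℂ
    + ((1 - u) * t ^ 2) • (Matrix.diagonal (fun i => (G.degree i : ℂ)) - (1 - u) • 1))

namespace LH

variable {V : Type*} [Fintype V] [DecidableEq V]

/-- Jacobi's formula. -/
lemma hasDerivAt_det (M : ℂ → Matrix V V ℂ) (M' : Matrix V V ℂ) (t : ℂ)
    (h : ∀ i j, HasDerivAt (fun s => M s i j) (M' i j) t) :
    HasDerivAt (fun s => (M s).det) (∑ i, ∑ j, (M t).adjugate i j * M' j i) t := by
  have h1 : HasDerivAt (fun s => (M s).det)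
      (∑ σ : Equiv.Perm V, ((Equiv.Perm.sign σ : ℤ) : ℂ) *
        ∑ i, (∏ j ∈ univ.erase i, M t (σ j) j) • M' (σ i) i) t := by
    simp only [Matrix.det_apply']
    refine HasDerivAt.fun_sum fun σ _ => ?_
    exact (HasDerivAt.fun_finsetProd fun i _ => h (σ i) i).const_mul _
  convert h1 using 1
  simp only [Finset.mul_sum]
  rw [Finset.sum_comm (s := (univ : Finset (Equiv.Perm V)))]
  refine Finset.sum_congr rfl fun i _ => ?_
  have h2 : ∑ j, (M t).adjugate i j * M' j i = ((M t).updateCol i (fun k => M' k i)).det := by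
    rw [← Matrix.cramer_apply, Matrix.cramer_eq_adjugate_mulVec]
    rfl
  rw [h2, Matrix.det_apply']
  refine Finset.sum_congr rfl fun σ _ => ?_
  rw [← Finset.mul_prod_erase univ _ (Finset.mem_univ i)]
  rw [Matrix.updateCol_self, smul_eq_mul, mul_comm (M' (σ i) i)]
  congr 2
  refine Finset.prod_congr rfl fun j hj => ?_
  rw [Matrix.updateCol_ne (Finset.ne_of_mem_erase hj)]

/-- every vertex reaches the root -/
def Reaches (r : V) (f : V → V) : Prop := ∀ i, ∃ k, f^[k] i = r

/-- transition matrix of `f` killed at `r` -/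
def P (r : V) (f : V → V) : Matrix V V ℝ :=
  Matrix.of fun i => if i = r then 0 else Pi.single (f i) 1

lemma P_mulVec (r : V) (f : V → V) (v : V → ℝ) (i : V) :
    (P r f).mulVec v i = if i = r then 0 else v (f i) := by
  unfold P Matrix.mulVec
  by_cases h : i = r <;> simp [h]

lemma P_pow (r : V) (f : V → V) (v : V → ℝ) (k : ℕ) : ∀ (N : ℕ) (i : V), k < N → f^[k] i = r →
    ((P r f) ^ N).mulVec v i = 0 := by
  induction k with
  | zero =>
    intro N i hN hi
    obtain ⟨N, rfl⟩ := Nat.exists_eq_add_of_lt hN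
    rw [zero_add, pow_succ', ← Matrix.mulVec_mulVec, P_mulVec, if_pos (by simpa using hi)]
  | succ k ih =>
    intro N i hN hi
    obtain ⟨N, rfl⟩ : ∃ N', N = N' + 1 := ⟨N - 1, by omega⟩
    rw [pow_succ', ← Matrix.mulVec_mulVec, P_mulVec]
    split_ifs
    · rfl
    · exact ih N (f i) (by omega) (by simpa using hi)

lemma det_of_reaches (r : V) (f : V → V) (h : Reaches r f) : (1 - P r f).det = 1 := by
  choose k hk using h
  have hn : IsNilpotent (P r f) := by
    refine ⟨∑ i, k i + 1, ?_⟩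
    apply Matrix.toLin'.injective
    refine LinearMap.ext fun v => ?_
    ext i
    simp only [Matrix.toLin'_apply, Matrix.zero_mulVec]
    refine P_pow r f v (k i) _ i ?_ (hk i)
    have := Finset.single_le_sum (f := k) (fun _ _ => Nat.zero_le _) (Finset.mem_univ i)
    omega
  have h1 := (Matrix.isNilpotent_charpoly_sub_pow_of_isNilpotent hn).eq_zero
  have h2 := Matrix.eval_charpoly (P r f) 1
  rw [sub_eq_zero.mp h1] at h2
  simpa using h2.symm

lemma det_of_not_reaches (r : V) (f : V → V) (h : ¬ Reaches r f) : (1 - P r f).det = 0 := by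
  classical
  unfold Reaches at h
  push Not at h
  obtain ⟨a, ha⟩ := h
  rw [← Matrix.exists_mulVec_eq_zero_iff]
  refine ⟨fun i => if ∀ k, f^[k] i ≠ r then 1 else 0, ?_, ?_⟩
  · intro h0
    have := congrFun h0 a
    simp [ha] at this
  · ext i
    rw [Matrix.sub_mulVec, Pi.sub_apply, Matrix.one_mulVec, P_mulVec]
    by_cases hi : i = r
    · have : ¬ ∀ k, f^[k] i ≠ r := fun h => h 0 hi
      rw [if_pos hi, if_neg this]; simp
    · have : (∀ k, f^[k] i ≠ r) ↔ (∀ k, f^[k] (f i) ≠ r) := by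
        constructor
        · intro h k
          exact h (k + 1)
        · intro h k
          cases k with
          | zero => exact hi
          | succ k => exact h k
      rw [if_neg hi, if_congr this rfl rfl]; simp

variable (G : SimpleGraph V) [DecidableRel G.Adj]

/-- admissible values -/
def S (r i : V) : Finset V := if i = r then {r} else G.neighborFinset i

open Classical in
lemma adj_rr (r : V) : (G.lapMatrix ℝ).adjugate r r =
    (((Fintype.piFinset (S G r)).filter (Reaches r)).card : ℝ) := by
  rw [Matrix.adjugate_apply]
  have h1 : ((G.lapMatrix ℝ).updateRow r (Pi.single r 1)) =
      fun i => ∑ j ∈ S G r i, (Pi.single i 1 - if i = r then 0 else Pi.single j 1 : V → ℝ) := by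
    funext i
    by_cases hi : i = r
    · subst hi
      simp [S]
    · rw [Matrix.updateRow_ne hi]
      funext j
      simp only [S, hi, if_false, Finset.sum_apply, Pi.sub_apply, Finset.sum_sub_distrib,
        Finset.sum_const, card_neighborFinset_eq_degree, nsmul_eq_mul]
      simp [lapMatrix, degMatrix, Matrix.diagonal_apply, Pi.single_apply, adjMatrix_apply, eq_comm]
  rw [h1]
  have h2 := MultilinearMap.map_sum_finset (Matrix.detRowAlternating (n := V) (R := ℝ)).toMultilinearMap
    (fun i j => (Pi.single i 1 - if i = r then 0 else Pi.single j 1 : V → ℝ)) (S G r)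
  refine Eq.trans h2 ?_
  rw [Finset.card_filter, Nat.cast_sum]
  refine Finset.sum_congr rfl fun f _ => ?_
  have h3 : (fun i => (Pi.single i 1 - if i = r then 0 else Pi.single (f i) 1 : V → ℝ))
     = (1 - P r f : Matrix V V ℝ) := by
    funext i j
    by_cases hi : i = r
    · simp [P, hi, Matrix.sub_apply, Matrix.one_apply, Pi.single_apply, eq_comm]
    · simp [P, hi, Ne.symm hi, Matrix.sub_apply, Matrix.one_apply, Pi.single_apply, eq_comm]
  show Matrix.det (fun i => (Pi.single i 1 - if i = r then 0 else Pi.single (f i) 1 : V → ℝ)) = _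
  rw [h3]
  by_cases hf : Reaches r f
  · rw [det_of_reaches r f hf]; simp [hf]
  · rw [det_of_not_reaches r f hf]; simp [hf]

/-- tree of `f` -/
def T (r : V) (f : V → V) : SimpleGraph V := SimpleGraph.fromRel fun i j => i ≠ r ∧ f i = j

lemma T_adj (r : V) (f : V → V) (h : ∀ i, i ≠ r → f i ≠ i) (i j : V) :
    (T r f).Adj i j ↔ (i ≠ r ∧ f i = j) ∨ (j ≠ r ∧ f j = i) := by
  unfold T
  rw [SimpleGraph.fromRel_adj]
  constructor
  · exact fun h => h.2
  · intro h'
    refine ⟨?_, h'⟩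
    rintro rfl
    rcases h' with h' | h' <;> exact h i h'.1 h'.2

lemma T_conn (r : V) (f : V → V) (h : ∀ i, i ≠ r → f i ≠ i) (hf : Reaches r f) :
    (T r f).Connected := by
  have key : ∀ k i, f^[k] i = r → (T r f).Reachable i r := by
    intro k
    induction k with
    | zero => intro i hi; rw [show i = r from hi]
    | succ k ih =>
      intro i hi
      by_cases hir : i = r
      · rw [hir]
      · have : (T r f).Adj i (f i) := (T_adj r f h _ _).2 (Or.inl ⟨hir, rfl⟩)
        exact this.reachable.trans (ih (f i) hi)
  have : Nonempty V := ⟨r⟩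
  refine ⟨fun i j => ?_⟩
  obtain ⟨k, hk⟩ := hf i
  obtain ⟨l, hl⟩ := hf j
  exact (key k i hk).trans (key l j hl).symm

lemma T_tree (r : V) (f : V → V) (h : ∀ i, i ≠ r → f i ≠ i) (hf : Reaches r f) :
    (T r f).IsTree := by
  classical
  have hc := T_conn r f h hf
  refine isTree_iff_connected_and_card.2 ⟨hc, le_antisymm ?_ hc.card_vert_le_card_edgeSet_add_one⟩
  have hsub : (T r f).edgeFinset ⊆ (univ.erase r).image (fun i => s(i, f i)) := by
    intro e
    induction e using Sym2.ind with
    | _ a b =>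
      rw [mem_edgeFinset, mem_edgeSet, T_adj r f h]
      simp only [Finset.mem_image, Finset.mem_erase, Finset.mem_univ, and_true]
      rintro (⟨h1, h2⟩ | ⟨h1, h2⟩)
      · exact ⟨a, h1, by rw [h2]⟩
      · exact ⟨b, h1, by rw [h2, Sym2.eq_swap]⟩
  have h1 := (Finset.card_le_card hsub).trans Finset.card_image_le
  rw [Finset.card_erase_of_mem (Finset.mem_univ r), Finset.card_univ] at h1
  have : 0 < Fintype.card V := Fintype.card_pos_iff.2 ⟨r⟩
  rw [Nat.card_eq_fintype_card, ← edgeFinset_card, Nat.card_eq_fintype_card]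
  omega

lemma T_inj (r : V) (f g : V → V) (hfr : f r = r) (hgr : g r = r)
    (h : ∀ i, i ≠ r → f i ≠ i) (h' : ∀ i, i ≠ r → g i ≠ i)
    (hf : Reaches r f) (hT : T r f = T r g) : f = g := by
  by_contra hne
  obtain ⟨i, hi⟩ := Function.ne_iff.1 hne
  have step : ∀ i, f i ≠ g i → i ≠ r := by
    rintro i hi rfl; exact hi (hfr.trans hgr.symm)
  have swap : ∀ i, f i ≠ g i → f i ≠ r ∧ g (f i) = i := by
    intro i hi
    have h1 : (T r f).Adj i (f i) := (T_adj r f h _ _).2 (Or.inl ⟨step i hi, rfl⟩)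
    rw [hT, T_adj r g h'] at h1
    rcases h1 with h1 | h1
    · exact absurd h1.2.symm hi
    · exact h1
  have next : ∀ i, f i ≠ g i → f (f i) ≠ g (f i) := by
    intro i hi h2
    obtain ⟨h3, h4⟩ := swap i hi
    rw [h4] at h2
    have : ∀ k, (f^[k] i = i ∨ f^[k] i = f i) := by
      intro k
      induction k with
      | zero => left; rfl
      | succ k ih =>
        rw [Function.iterate_succ_apply']
        rcases ih with ih | ih <;> rw [ih]
        · right; rfl
        · left; exact h2
    obtain ⟨k, hk⟩ := hf i
    rcases this k with h5 | h5
    · exact step i hi (h5.symm.trans hk)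
    · exact h3 (h5.symm.trans hk)
  have all : ∀ k, f (f^[k] i) ≠ g (f^[k] i) := by
    intro k
    induction k with
    | zero => exact hi
    | succ k ih => rw [Function.iterate_succ_apply']; exact next _ ih
  obtain ⟨k, hk⟩ := hf i
  exact step _ (all k) hk

lemma T_surj (r : V) (H : SimpleGraph V) (hH : H.IsTree) :
    ∃ f : V → V, f r = r ∧ (∀ i, i ≠ r → H.Adj i (f i)) ∧ Reaches r f ∧ T r f = H := by
  classical
  have hex : ∀ i, i ≠ r → ∃ j, H.Adj i j ∧ H.dist j r < H.dist i r := by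
    intro i hi
    obtain ⟨p, hp⟩ := hH.connected.exists_walk_length_eq_dist i r
    cases p with
    | nil => exact absurd rfl hi
    | cons hadj q =>
      refine ⟨_, hadj, ?_⟩
      have := SimpleGraph.dist_le q
      rw [SimpleGraph.Walk.length_cons] at hp
      omega
  choose! g hg hd using hex
  let f : V → V := fun i => if i = r then r else g i
  have hfi : ∀ i, i ≠ r → f i = g i := fun i hi => if_neg hi
  have hfa : ∀ i, i ≠ r → H.Adj i (f i) := fun i hi => by rw [hfi i hi]; exact hg i hi
  have hreach : Reaches r f := by
    have : ∀ d i, H.dist i r ≤ d → ∃ k, f^[k] i = r := by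
      intro d
      induction d with
      | zero =>
        intro i hi
        exact ⟨0, hH.connected.dist_eq_zero_iff.1 (Nat.le_zero.1 hi)⟩
      | succ d ih =>
        intro i hi
        by_cases hir : i = r
        · exact ⟨0, hir⟩
        · have := hd i hir
          obtain ⟨k, hk⟩ := ih (f i) (by rw [hfi i hir]; omega)
          exact ⟨k + 1, hk⟩
    exact fun i => this _ i le_rfl
  have hne : ∀ i, i ≠ r → f i ≠ i := fun i hi => (hfa i hi).ne'
  refine ⟨f, if_pos rfl, hfa, hreach, ?_⟩
  have hle : T r f ≤ H := by
    intro a b hab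
    rw [T_adj r f hne] at hab
    rcases hab with ⟨h1, h2⟩ | ⟨h1, h2⟩
    · rw [← h2]; exact hfa a h1
    · rw [← h2]; exact (hfa b h1).symm
  exact le_antisymm hle ((isTree_iff_minimal_connected.1 hH).2 (T_conn r f hne hreach) hle)

open Classical in
lemma card_eq (r : V) :
    ((Fintype.piFinset (S G r)).filter (Reaches r)).card = numSpanningTrees G := by
  unfold numSpanningTrees
  rw [Nat.card_eq_fintype_card, Fintype.card_subtype]
  have hS : ∀ f, f ∈ (Fintype.piFinset (S G r)).filter (Reaches r) ↔
      (f r = r ∧ (∀ i, i ≠ r → G.Adj i (f i))) ∧ Reaches r f := by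
    intro f
    rw [Finset.mem_filter, Fintype.mem_piFinset]
    refine and_congr_left fun _ => ⟨fun h => ⟨?_, fun i hi => ?_⟩, fun h i => ?_⟩
    · simpa [S] using h r
    · simpa [S, hi] using h i
    · by_cases hi : i = r
      · subst hi; simpa [S] using h.1
      · simpa [S, hi] using h.2 i hi
  refine Finset.card_bij (fun f _ => T r f) ?_ ?_ ?_
  · intro f hf
    obtain ⟨⟨h1, h2⟩, h3⟩ := (hS f).1 hf
    have hne : ∀ i, i ≠ r → f i ≠ i := fun i hi => (h2 i hi).ne'
    rw [Finset.mem_filter]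
    refine ⟨Finset.mem_univ _, ?_, T_tree r f hne h3⟩
    intro a b hab
    rw [T_adj r f hne] at hab
    rcases hab with ⟨h4, h5⟩ | ⟨h4, h5⟩
    · rw [← h5]; exact h2 a h4
    · rw [← h5]; exact (h2 b h4).symm
  · intro f hf g hg hT
    obtain ⟨⟨h1, h2⟩, h3⟩ := (hS f).1 hf
    obtain ⟨⟨h1', h2'⟩, h3'⟩ := (hS g).1 hg
    exact T_inj r f g h1 h1' (fun i hi => (h2 i hi).ne') (fun i hi => (h2' i hi).ne') h3 hT
  · intro H hH
    rw [Finset.mem_filter] at hH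
    obtain ⟨f, h1, h2, h3, h4⟩ := T_surj r H hH.2.2
    exact ⟨f, (hS f).2 ⟨⟨h1, fun i hi => hH.2.1 (h2 i hi)⟩, h3⟩, h4⟩

/-- Matrix tree theorem. -/
lemma adj_real (hG : G.Connected) (i j : V) :
    (G.lapMatrix ℝ).adjugate i j = numSpanningTrees G := by
  have : Nonempty V := hG.nonempty
  have hcol : ∀ i i' j, (G.lapMatrix ℝ).adjugate i j = (G.lapMatrix ℝ).adjugate i' j := by
    intro i i' j
    have h0 : (G.lapMatrix ℝ).mulVec (fun k => (G.lapMatrix ℝ).adjugate k j) = 0 := by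
      have h := Matrix.mul_adjugate (G.lapMatrix ℝ)
      rw [det_lapMatrix_eq_zero, zero_smul] at h
      ext k
      exact congrFun (congrFun h k) j
    exact (lapMatrix_mulVec_eq_zero_iff_forall_reachable G).1 h0 i i' (hG.preconnected i i')
  rw [hcol i j j, adj_rr, card_eq]

lemma adj_complex (hG : G.Connected) (i j : V) :
    (G.lapMatrix ℂ).adjugate i j = numSpanningTrees G := by
  have h := RingHom.map_adjugate (algebraMap ℝ ℂ) (G.lapMatrix ℝ)
  have hL : (algebraMap ℝ ℂ).mapMatrix (G.lapMatrix ℝ) = G.lapMatrix ℂ := by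
    ext a b
    simp only [lapMatrix, degMatrix, RingHom.mapMatrix_apply, Matrix.map_apply, Matrix.sub_apply,
      Matrix.diagonal_apply, adjMatrix_apply]
    split_ifs <;> simp
  rw [hL] at h
  rw [← h, RingHom.mapMatrix_apply, Matrix.map_apply, adj_real G hG]
  simp

lemma sum_adj (m : ℕ) (hm : G.edgeFinset.card = m) :
    ∑ i, ∑ j, (G.adjMatrix ℂ) j i = 2 * m := by
  rw [← hm, Finset.sum_comm]
  have h := congrArg (Nat.cast : ℕ → ℂ) G.sum_degrees_eq_twice_card_edges
  push_cast at h
  rw [← h]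
  refine Finset.sum_congr rfl fun i _ => ?_
  rw [degree_eq_sum_if_adj]
  simp [adjMatrix_apply]

lemma sum_deg (m : ℕ) (hm : G.edgeFinset.card = m) :
    ∑ i, (G.degree i : ℂ) = 2 * m := by
  rw [← hm]
  exact_mod_cast congrArg (Nat.cast : ℕ → ℂ) G.sum_degrees_eq_twice_card_edges

/-- Common derivative computation. -/
lemma main_deriv (hG : G.Connected) (m : ℕ) (hm : G.edgeFinset.card = m) (t t₀ : ℂ)
    (M : ℂ → Matrix V V ℂ) (hM : M t₀ = t • G.lapMatrix ℂ) (a b c : ℂ)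
    (h : ∀ i j, HasDerivAt (fun s => M s i j)
      ((a • G.adjMatrix ℂ + b • Matrix.diagonal (fun i => (G.degree i : ℂ)) + c • 1 :
        Matrix V V ℂ) i j) t₀) :
    deriv (fun s => (M s).det) t₀ = t ^ (Fintype.card V - 1) * numSpanningTrees G *
      (2 * m * (a + b) + c * Fintype.card V) := by
  rw [(hasDerivAt_det M _ t₀ h).deriv, hM, Matrix.adjugate_smul]
  simp only [Matrix.smul_apply, adj_complex G hG, smul_eq_mul]
  simp only [← Finset.mul_sum]
  congr 1
  simp only [Matrix.add_apply, Matrix.smul_apply, smul_eq_mul, Finset.sum_add_distrib,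
    ← Finset.mul_sum, sum_adj G m hm]
  simp only [Matrix.diagonal_apply, Matrix.one_apply, Finset.sum_ite_eq', Finset.mem_univ, if_true,
    sum_deg G m hm]
  simp
  ring

end LH

theorem stmt7 {n : ℕ} (G : SimpleGraph (Fin n)) [DecidableRel G.Adj]
    (hG : G.Connected) (m : ℕ) (hm : G.edgeFinset.card = m) :
    ∀ t : ℂ, t ≠ 0 →
      deriv (fun s => FLH G (1 - 1/t) s) t
          = 2 * t ^ ((n : ℤ) - 2) * ((m : ℂ) * t - n) * (numSpanningTrees G : ℂ)
      ∧ deriv (fun v => FLH G v t) (1 - 1/t)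
          = -(2 * t ^ (n : ℤ) * ((m : ℂ) * t - n) * (numSpanningTrees G : ℂ)) := by
  intro t ht
  obtain ⟨n, rfl⟩ : ∃ k, n = k + 1 := by
    obtain ⟨r⟩ := hG.nonempty
    exact ⟨n - 1, by have := r.isLt; omega⟩
  have hpt : (1 : Matrix (Fin (n + 1)) (Fin (n + 1)) ℂ) - t • G.adjMatrix ℂ
      + ((1 - (1 - 1 / t)) * t ^ 2) • (Matrix.diagonal (fun i => (G.degree i : ℂ))
        - (1 - (1 - 1 / t)) • 1) = t • G.lapMatrix ℂ := by
    have e1 : (1 - (1 - 1 / t)) * t ^ 2 = t := by field_simp; ring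
    have e2 : (1 - (1 - 1 / t)) = 1 / t := by ring
    rw [e1, e2, lapMatrix, degMatrix, smul_sub, smul_sub, smul_smul, mul_one_div_cancel ht, one_smul]
    abel
  have hz : t ^ (((n + 1 : ℕ) : ℤ) - 2) = t ^ n / t := by
    rw [show (((n + 1 : ℕ) : ℤ) - 2) = (n : ℤ) - 1 by push_cast; ring, zpow_sub_one₀ ht,
      zpow_natCast]
    rfl
  constructor
  · unfold FLH
    rw [LH.main_deriv G hG m hm t t _ hpt (-1) 2 (-(2 / t)) ?_, hz]
    · simp only [Fintype.card_fin, Nat.add_sub_cancel]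
      field_simp
      push_cast
      ring
    · intro i j
      simp only [Matrix.add_apply, Matrix.sub_apply, Matrix.smul_apply, smul_eq_mul]
      have h1 := (hasDerivAt_id' t).mul_const (G.adjMatrix ℂ i j)
      have h2 := (((hasDerivAt_pow 2 t).const_mul (1 - (1 - 1 / t))).mul_const
        (Matrix.diagonal (fun i => (G.degree i : ℂ)) i j
          - (1 - (1 - 1 / t)) * (1 : Matrix (Fin (n + 1)) (Fin (n + 1)) ℂ) i j))
      refine ((h1.const_sub ((1 : Matrix (Fin (n + 1)) (Fin (n + 1)) ℂ) i j)).add h2).congr_deriv ?_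
      field_simp
      push_cast
      ring
  · unfold FLH
    rw [LH.main_deriv G hG m hm t (1 - 1 / t) _ hpt 0 (-t ^ 2) (2 * t) ?_, zpow_natCast]
    · simp only [Fintype.card_fin, Nat.add_sub_cancel]
      push_cast
      ring
    · intro i j
      simp only [Matrix.add_apply, Matrix.sub_apply, Matrix.smul_apply, smul_eq_mul]
      have h0 := (hasDerivAt_id' (1 - 1 / t)).const_sub 1
      have h2 := (h0.mul_const (t ^ 2)).mul ((h0.mul_const
        ((1 : Matrix (Fin (n + 1)) (Fin (n + 1)) ℂ) i j)).const_sub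
          (Matrix.diagonal (fun i => (G.degree i : ℂ)) i j))
      refine (h2.const_add (((1 : Matrix (Fin (n + 1)) (Fin (n + 1)) ℂ) i j)
        - t * G.adjMatrix ℂ i j)).congr_deriv ?_
      field_simp
      ring
end

section
/- Let G be a connected finite graph with n vertices and m edges, and set F(u,t) = det(I_n − t·A(G) + (1−u)t^2(D − (1−u)I_n)). Then ∂F/∂t |_{(0,1)} = −∂F/∂u |_{(0,1)} = 2(m − n)·κ(G). -/
open Finset SimpleGraph

namespace MTT

variable {V : Type*}

/-- Parent function rooted at `r`. -/
def Good (r : V) (f : V → V) : Prop := f r = r ∧ ∃ d : V → ℕ, ∀ i, i ≠ r → d (f i) < d i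

/-- The graph of a parent function. -/
def gr (f : V → V) : SimpleGraph V where
  Adj i j := i ≠ j ∧ (f i = j ∨ f j = i)
  symm := ⟨fun i j h => ⟨h.1.symm, h.2.symm⟩⟩
  loopless := ⟨fun i h => h.1 rfl⟩

lemma Good.ne {r : V} {f : V → V} (h : Good r f) {i : V} (hi : i ≠ r) : i ≠ f i := by
  obtain ⟨_, d, hd⟩ := h
  intro h
  have := hd i hi
  rw [← h] at this
  exact lt_irrefl _ this

lemma Good.connected {r : V} {f : V → V} (h : Good r f) : (gr f).Connected := by
  have h' := h
  obtain ⟨_, d, hd⟩ := h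
  have key : ∀ k i, d i = k → (gr f).Reachable i r := by
    intro k
    induction k using Nat.strong_induction_on with
    | _ k ih =>
      intro i hi
      by_cases hir : i = r
      · rw [hir]
      · have h1 : (gr f).Adj i (f i) := ⟨h'.ne hir, Or.inl rfl⟩
        exact h1.reachable.trans (ih _ (hi ▸ hd i hir) _ rfl)
  haveI : Nonempty V := ⟨r⟩
  exact SimpleGraph.Connected.mk fun i j => (key _ i rfl).trans (key _ j rfl).symm

lemma Good.eq_of_le {r : V} {f g : V → V} (hf : Good r f) (hg : Good r g) (h : gr g ≤ gr f) :
    g = f := by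
  have hg' := hg
  obtain ⟨hr, d, hd⟩ := hg
  have key : ∀ k i, d i = k → g i = f i := by
    intro k
    induction k using Nat.strong_induction_on with
    | _ k ih =>
      intro i hi
      by_cases hir : i = r
      · rw [hir, hr, hf.1]
      · have h1 : (gr g).Adj i (g i) := ⟨hg'.ne hir, Or.inl rfl⟩
        rcases (h h1).2 with h2 | h2
        · exact h2.symm
        · have h3 := ih _ (hi ▸ hd i hir) _ rfl
          rw [h2] at h3
          have h4 : g i ≠ r := fun h5 => hir (by rw [← h3, h5, hr])
          have h5 := hd _ h4
          have h6 := hd _ hir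
          rw [h3] at h5
          omega
  exact funext fun i => key _ i rfl

lemma exists_good {T : SimpleGraph V} (hT : T.IsTree) (r : V) :
    ∃ f : V → V, Good r f ∧ gr f = T ∧ ∀ i, i ≠ r → T.Adj i (f i) := by
  have hex : ∀ i, i ≠ r → ∃ j, T.Adj i j ∧ T.dist j r < T.dist i r := by
    intro i hi
    obtain ⟨p, hp⟩ := hT.connected.exists_walk_length_eq_dist i r
    cases p with
    | nil => exact absurd rfl hi
    | @cons _ j _ h q =>
      refine ⟨j, h, ?_⟩
      have := SimpleGraph.dist_le q
      simp only [SimpleGraph.Walk.length_cons] at hp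
      omega
  classical
  choose f hf using hex
  let g : V → V := fun i => if h : i ≠ r then f i h else r
  have hg : ∀ i, i ≠ r → T.Adj i (g i) ∧ T.dist (g i) r < T.dist i r := by
    intro i hi
    simp only [g, dif_pos hi]
    exact hf i hi
  have hgr : g r = r := by simp [g]
  have hgood : Good r g := ⟨hgr, fun i => T.dist i r, fun i hi => (hg i hi).2⟩
  refine ⟨g, hgood, ?_, fun i hi => (hg i hi).1⟩
  have hle : gr g ≤ T := by
    intro i j hij
    obtain ⟨hne, h | h⟩ := hij
    · have : i ≠ r := fun h' => hne (by rw [← h, h', hgr])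
      exact h ▸ (hg i this).1
    · have : j ≠ r := fun h' => hne (by rw [← h, h', hgr])
      exact (h ▸ (hg j this).1).symm
  exact le_antisymm hle ((SimpleGraph.isTree_iff_minimal_connected.1 hT).2 hgood.connected hle)

lemma Good.isTree {r : V} {f : V → V} (h : Good r f) : (gr f).IsTree := by
  obtain ⟨T, hle, hT⟩ := h.connected.exists_isTree_le
  obtain ⟨g, hg, rfl, _⟩ := exists_good hT r
  rwa [← h.eq_of_le hg hle]

variable [Fintype V] [DecidableEq V]

/-- Row-type matrix of a parent function. -/
def N (r : V) (f : V → V) : Matrix V V ℝ :=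
  fun i => if i = r then Pi.single r 1 else Pi.single i 1 - Pi.single (f i) 1

lemma det_N_good {r : V} {f : V → V} (h : Good r f) : (N r f).det = 1 := by
  obtain ⟨hr, d, hd⟩ := h
  have hBT : (N r f).BlockTriangular (OrderDual.toDual ∘ d) := by
    intro i j hij
    have hij' : d i < d j := hij
    have hne : j ≠ i := by rintro rfl; exact lt_irrefl _ hij'
    unfold N
    split_ifs with hi
    · subst hi; simp [hne]
    · have h2 : j ≠ f i := by
        intro h
        have := hd i hi
        rw [← h] at this
        omega
      simp [hne, h2]
  rw [hBT.det]
  refine Finset.prod_eq_one fun a _ => ?_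
  have : (N r f).toSquareBlock (OrderDual.toDual ∘ d) a = 1 := by
    ext ⟨i, hi⟩ ⟨j, hj⟩
    have hij : d i = d j := by
      have := hi.trans hj.symm
      simpa using this
    simp only [Matrix.toSquareBlock_def, Matrix.of_apply, Matrix.one_apply, Subtype.mk.injEq]
    unfold N
    split_ifs with hir h1 h1
    · subst hir; subst h1; simp
    · subst hir; simp [Ne.symm h1]
    · subst h1
      have h2 : i ≠ f i := by
        intro h
        have := hd i hir
        rw [← h] at this
        omega
      simp [h2]
    · have h2 : j ≠ f i := by
        intro h
        have := hd i hir
        rw [← h] at this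
        omega
      simp [Ne.symm h1, h2]
  rw [this, Matrix.det_one]

lemma det_N_bad {r : V} {f : V → V} (hr : f r = r) (h : ¬ Good r f) : (N r f).det = 0 := by
  classical
  by_cases hall : ∀ i, ∃ k, f^[k] i = r
  · exfalso
    apply h
    refine ⟨hr, fun i => Nat.find (hall i), fun i hi => ?_⟩
    have h1 := Nat.find_spec (hall i)
    obtain ⟨k, hk⟩ : ∃ k, Nat.find (hall i) = k + 1 := by
      apply Nat.exists_eq_succ_of_ne_zero
      intro h0
      rw [h0] at h1
      exact hi h1
    rw [hk, Function.iterate_succ_apply] at h1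
    have := Nat.find_min' (hall (f i)) h1
    show Nat.find (hall (f i)) < Nat.find (hall i)
    omega
  · push Not at hall
    obtain ⟨i₀, hi₀⟩ := hall
    apply Matrix.exists_mulVec_eq_zero_iff.1
    refine ⟨fun i => if ∃ k, f^[k] i = r then 0 else 1, ?_, ?_⟩
    · intro h0
      have := congrFun h0 i₀
      simp [hi₀] at this
    · funext i
      have hrr : ∃ k, f^[k] r = r := ⟨0, rfl⟩
      simp only [Matrix.mulVec, N]
      split_ifs with hi
      · rw [single_dotProduct]
        simp only [if_pos hrr]; simp
      · rw [sub_dotProduct, single_dotProduct, single_dotProduct]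
        have : (∃ k, f^[k] (f i) = r) ↔ ∃ k, f^[k] i = r := by
          constructor
          · rintro ⟨k, hk⟩
            exact ⟨k + 1, hk⟩
          · rintro ⟨k, hk⟩
            cases k with
            | zero => exact absurd hk hi
            | succ k => exact ⟨k, hk⟩
        simp only [this]
        simp

variable (G : SimpleGraph V) [DecidableRel G.Adj]

lemma adj_diag (r : V) : (G.lapMatrix ℝ).adjugate r r = (numSpanningTrees G : ℝ) := by
  classical
  let A : V → Finset V := fun i => if i = r then {r} else G.neighborFinset i
  let g : V → V → V → ℝ := fun i j =>
    if i = r then Pi.single r 1 else Pi.single i 1 - Pi.single j 1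
  have h1 : (G.lapMatrix ℝ).updateRow r (Pi.single r 1) = fun i => ∑ j ∈ A i, g i j := by
    funext i k
    by_cases hi : i = r
    · subst hi
      simp [A, g]
    · simp only [A, g, if_neg hi, Matrix.updateRow_ne hi, Finset.sum_apply, Pi.sub_apply,
        Finset.sum_sub_distrib, Finset.sum_const, SimpleGraph.card_neighborFinset_eq_degree]
      simp [SimpleGraph.lapMatrix, SimpleGraph.degMatrix, Matrix.diagonal_apply,
        Pi.single_apply, SimpleGraph.adjMatrix_apply, eq_comm]
  rw [Matrix.adjugate_apply, h1]
  have h2 := (Matrix.detRowAlternating (n := V) (R := ℝ)).toMultilinearMap.map_sum_finset g A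
  have h3 : Matrix.det (fun i => ∑ j ∈ A i, g i j) =
      ∑ f ∈ Fintype.piFinset A, (N r f).det := h2
  rw [h3]
  have hA : ∀ f ∈ Fintype.piFinset A, f r = r := by
    intro f hf
    have := Fintype.mem_piFinset.1 hf r
    simpa [A] using this
  have h4 : ∀ f ∈ Fintype.piFinset A, (N r f).det = if Good r f then 1 else 0 := by
    intro f hf
    split_ifs with h
    · exact det_N_good h
    · exact det_N_bad (hA f hf) h
  rw [Finset.sum_congr rfl h4, Finset.sum_boole, numSpanningTrees]
  congr 1
  rw [← Fintype.card_coe, ← Nat.card_eq_fintype_card]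
  have hadj : ∀ f ∈ Fintype.piFinset A, ∀ i, i ≠ r → G.Adj i (f i) := by
    intro f hf i hi
    have := Fintype.mem_piFinset.1 hf i
    simpa [A, hi] using this
  refine Nat.card_eq_of_bijective (fun f => ⟨gr f.1, ?_, ?_⟩) ⟨?_, ?_⟩
  · have hf := Finset.mem_filter.1 f.2
    intro i j hij
    obtain ⟨hne, h | h⟩ := hij
    · have : i ≠ r := fun h' => hne (by rw [← h, h', hA _ hf.1])
      exact h ▸ hadj _ hf.1 i this
    · have : j ≠ r := fun h' => hne (by rw [← h, h', hA _ hf.1])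
      exact (h ▸ hadj _ hf.1 j this).symm
  · exact (Finset.mem_filter.1 f.2).2.isTree
  · intro f f' h
    have h' : gr f.1 = gr f'.1 := congrArg Subtype.val h
    exact Subtype.ext ((Finset.mem_filter.1 f'.2).2.eq_of_le (Finset.mem_filter.1 f.2).2 h'.le)
  · rintro ⟨T, hle, hT⟩
    obtain ⟨f, hf, hfT, hfa⟩ := exists_good hT r
    refine ⟨⟨f, Finset.mem_filter.2 ⟨Fintype.mem_piFinset.2 fun i => ?_, hf⟩⟩, Subtype.ext hfT⟩
    by_cases hi : i = r
    · subst hi; simp [A, hf.1]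
    · simpa [A, hi] using hle (hfa i hi)

lemma adj_real (hG : G.Connected) (i j : V) :
    (G.lapMatrix ℝ).adjugate i j = (numSpanningTrees G : ℝ) := by
  haveI : Nonempty V := ⟨i⟩
  have h := Matrix.mul_adjugate (G.lapMatrix ℝ)
  rw [SimpleGraph.det_lapMatrix_eq_zero, zero_smul] at h
  have h2 : (G.lapMatrix ℝ).mulVec (fun k => (G.lapMatrix ℝ).adjugate k j) = 0 := by
    funext k
    exact congrFun (congrFun h k) j
  rw [G.lapMatrix_mulVec_eq_zero_iff_forall_reachable] at h2
  rw [← adj_diag G j]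
  exact h2 i j (hG.preconnected i j)

lemma adj_complex (hG : G.Connected) (i j : V) :
    (G.lapMatrix ℂ).adjugate i j = (numSpanningTrees G : ℂ) := by
  have h := RingHom.map_adjugate Complex.ofRealHom (G.lapMatrix ℝ)
  have h1 : Complex.ofRealHom.mapMatrix (G.lapMatrix ℝ) = G.lapMatrix ℂ := by
    ext a b
    by_cases hab : a = b <;> by_cases hadj : G.Adj a b <;>
    simp [SimpleGraph.lapMatrix, SimpleGraph.degMatrix, Matrix.diagonal_apply,
      SimpleGraph.adjMatrix_apply, hab, hadj]
  rw [h1] at h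
  rw [← h, RingHom.mapMatrix_apply, Matrix.map_apply, adj_real G hG]
  simp

lemma deriv_det (M : ℂ → Matrix V V ℂ) (M' : Matrix V V ℂ) (x : ℂ)
    (h : ∀ i j, HasDerivAt (fun s => M s i j) (M' i j) x) :
    HasDerivAt (fun s => (M s).det) (∑ i, ∑ j, M' i j * (M x).adjugate j i) x := by
  let D : ContinuousMultilinearMap ℂ (fun _ : V => V → ℂ) ℂ :=
    { (Matrix.detRowAlternating (n := V) (R := ℂ)).toMultilinearMap with
      cont := Continuous.matrix_det (A := fun m : V → V → ℂ => (m : Matrix V V ℂ)) continuous_id }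
  have h1 : ∀ i, HasDerivAt (fun s => M s i) (M' i) x := fun i => hasDerivAt_pi.2 (h i)
  have h2 := (HasFDerivAt.multilinear_comp (f := D) (fun i => (h1 i).hasFDerivAt)).hasDerivAt
  have h3 : HasDerivAt (fun s => (M s).det) _ x := h2
  convert h3 using 1
  rw [ContinuousLinearMap.sum_apply]
  refine Finset.sum_congr rfl fun i _ => ?_
  have h4 : ∀ v : V → ℂ, D.toContinuousLinearMap (fun j => M x j) i v = ((M x).updateRow i v).det :=
    fun v => rfl
  simp only [ContinuousLinearMap.comp_apply, h4, ContinuousLinearMap.toSpanSingleton_apply,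
    one_smul]
  rw [← Matrix.cramer_transpose_apply, Matrix.cramer_eq_adjugate_mulVec,
    ← Matrix.adjugate_transpose]
  simp [Matrix.mulVec, dotProduct, mul_comm]

lemma sum_deg : ∑ i, (G.degree i : ℂ) = 2 * (G.edgeFinset.card : ℂ) := by
  exact_mod_cast G.sum_degrees_eq_twice_card_edges

lemma sum_adj : ∑ i, ∑ j, G.adjMatrix ℂ i j = 2 * (G.edgeFinset.card : ℂ) := by
  rw [← sum_deg]
  refine Finset.sum_congr rfl fun i _ => ?_
  rw [SimpleGraph.degree_eq_sum_if_adj]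
  simp [SimpleGraph.adjMatrix_apply]

lemma sum_one : ∑ i : V, ∑ j : V, (1 : Matrix V V ℂ) i j = (Fintype.card V : ℂ) := by
  simp [Matrix.one_apply]

lemma sum_diag : ∑ i : V, ∑ j : V, Matrix.diagonal (fun i => (G.degree i : ℂ)) i j
    = 2 * (G.edgeFinset.card : ℂ) := by
  rw [← sum_deg]
  simp [Matrix.diagonal_apply]

end MTT

theorem stmt8 {n : ℕ} (G : SimpleGraph (Fin n)) [DecidableRel G.Adj]
    (hG : G.Connected) (m : ℕ) (hm : G.edgeFinset.card = m) :
    deriv (fun s => FLH G 0 s) 1 = 2 * ((m : ℂ) - n) * (numSpanningTrees G : ℂ)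
    ∧ deriv (fun v => FLH G v 1) 0 = -(2 * ((m : ℂ) - n) * (numSpanningTrees G : ℂ)) := by
  have hA := MTT.sum_adj G
  have hD := MTT.sum_diag G
  have hI := MTT.sum_one (V := Fin n)
  rw [hm] at hA hD
  rw [Fintype.card_fin] at hI
  constructor
  · have h := MTT.deriv_det (fun t : ℂ => (1 : Matrix (Fin n) (Fin n) ℂ) - t • G.adjMatrix ℂ
      + ((1 - 0) * t ^ 2) • (Matrix.diagonal (fun i => (G.degree i : ℂ)) - (1 - 0 : ℂ) • 1))
      (- G.adjMatrix ℂ + (2 : ℂ) • (Matrix.diagonal (fun i => (G.degree i : ℂ)) - 1)) 1 (by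
        intro i j
        simp only [Matrix.add_apply, Matrix.sub_apply, Matrix.smul_apply, Matrix.neg_apply,
          smul_eq_mul]
        have h1 := (((hasDerivAt_id (1 : ℂ)).mul_const (G.adjMatrix ℂ i j)).const_sub
          ((1 : Matrix (Fin n) (Fin n) ℂ) i j)).add
          ((((hasDerivAt_id (1 : ℂ)).pow 2).const_mul (1 - 0 : ℂ)).mul_const
          (Matrix.diagonal (fun i => (G.degree i : ℂ)) i j -
            (1 - 0) * (1 : Matrix (Fin n) (Fin n) ℂ) i j))
        refine HasDerivAt.congr_deriv h1 ?_
        simp)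
    have hL : (1 : Matrix (Fin n) (Fin n) ℂ) - (1 : ℂ) • G.adjMatrix ℂ
      + ((1 - 0) * (1 : ℂ) ^ 2) • (Matrix.diagonal (fun i => (G.degree i : ℂ)) - (1 - 0 : ℂ) • 1)
      = G.lapMatrix ℂ := by
      simp [SimpleGraph.lapMatrix, SimpleGraph.degMatrix]
    simp only [hL, MTT.adj_complex G hG, ← Finset.sum_mul] at h
    refine (HasDerivAt.deriv h).trans ?_
    congr 1
    simp only [Matrix.add_apply, Matrix.sub_apply, Matrix.smul_apply, Matrix.neg_apply,
      smul_eq_mul, Finset.sum_add_distrib, Finset.sum_neg_distrib, ← Finset.mul_sum,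
      Finset.sum_sub_distrib, hA, hD, hI]
    ring
  · have h := MTT.deriv_det (fun u : ℂ => (1 : Matrix (Fin n) (Fin n) ℂ) - (1 : ℂ) • G.adjMatrix ℂ
      + ((1 - u) * 1 ^ 2) • (Matrix.diagonal (fun i => (G.degree i : ℂ)) - (1 - u : ℂ) • 1))
      ((2 : ℂ) • 1 - (Matrix.diagonal (fun i => (G.degree i : ℂ)))) 0 (by
        intro i j
        simp only [Matrix.add_apply, Matrix.sub_apply, Matrix.smul_apply,
          smul_eq_mul]
        have h0 := (hasDerivAt_id (0 : ℂ)).const_sub 1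
        have h1 := ((h0.mul_const (1 ^ 2 : ℂ)).mul
          ((h0.mul_const ((1 : Matrix (Fin n) (Fin n) ℂ) i j)).const_sub
          (Matrix.diagonal (fun i => (G.degree i : ℂ)) i j))).const_add
          ((1 : Matrix (Fin n) (Fin n) ℂ) i j - 1 * G.adjMatrix ℂ i j)
        refine HasDerivAt.congr_deriv h1 ?_
        simp
        ring)
    have hL : (1 : Matrix (Fin n) (Fin n) ℂ) - (1 : ℂ) • G.adjMatrix ℂ
      + ((1 - 0) * (1 : ℂ) ^ 2) • (Matrix.diagonal (fun i => (G.degree i : ℂ)) - (1 - 0 : ℂ) • 1)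
      = G.lapMatrix ℂ := by
      simp [SimpleGraph.lapMatrix, SimpleGraph.degMatrix]
    simp only [hL, MTT.adj_complex G hG, ← Finset.sum_mul] at h
    refine (HasDerivAt.deriv h).trans ?_
    rw [← neg_mul]
    congr 1
    simp only [Matrix.sub_apply, Matrix.smul_apply,
      smul_eq_mul, ← Finset.mul_sum,
      Finset.sum_sub_distrib, hA, hD, hI]
    ring
end

section
/- Let G be a connected finite graph with n vertices and m edges, and set F(u,t) = det(I_n − t·A(G) + (1−u)t^2(D − (1−u)I_n)). Then, as identities of rational functions in t: ∂²F/∂t² |_{(1−1/t,t)} = 2 t^{n−4} κ(G)(Kf^z(t) + nt(2mt − 2n + 1)); ∂²F/∂t∂u |_{(1−1/t,t)} = 2 t^{n−2} κ(G)((n − mt)(n+1)t − Kf^z(t)); and ∂²F/∂u² |_{(1−1/t,t)} = 2 t^{n} κ(G)(Kf^z(t) − nt), where Kf^z(t) = Kf^* t^2 − 2 Kf^+ t + 4 Kf. -/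
open Finset SimpleGraph

namespace LHaux

open Matrix

/-- `f` eventually maps every vertex to the root `r`. -/
def Good {V : Type*} (r : V) (f : V → V) : Prop := ∀ i, ∃ k : ℕ, f^[k] i = r

/-- Row `i` of the functional matrix with target `j`. -/
noncomputable def rowf {V : Type*} [DecidableEq V] (r i j : V) : V → ℂ :=
  if i = r then Pi.single r 1 else Pi.single i 1 - Pi.single j 1

lemma det_rowf_bad {V : Type*} [Fintype V] [DecidableEq V] (r : V) (f : V → V) (hr : f r = r)
    (hf : ¬ Good r f) : det (Matrix.of fun i => rowf r i (f i)) = 0 := by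
  classical
  unfold Good at hf
  push Not at hf
  obtain ⟨i₀, hi₀⟩ := hf
  rw [← Matrix.exists_mulVec_eq_zero_iff]
  refine ⟨fun i => if ∃ k : ℕ, f^[k] i = r then 0 else 1, ?_, ?_⟩
  · intro h
    have := congrFun h i₀
    simp [hi₀] at this
  · ext i
    have hiff : i ≠ r → ((∃ k : ℕ, f^[k] i = r) ↔ (∃ k : ℕ, f^[k] (f i) = r)) := by
      intro hi
      constructor
      · rintro ⟨k, hk⟩
        cases k with
        | zero => exact absurd hk hi
        | succ k => exact ⟨k, by simpa using hk⟩
      · rintro ⟨k, hk⟩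
        exact ⟨k + 1, by simpa using hk⟩
    by_cases hi : i = r
    · subst hi
      have : ∃ k : ℕ, f^[k] i = i := ⟨0, rfl⟩
      simp [Matrix.mulVec, rowf, this]
    · simp only [Matrix.mulVec, rowf, hi, Matrix.of_apply, if_false, sub_dotProduct,
        single_dotProduct, one_mul, Pi.zero_apply]
      simp only [hiff hi, sub_self]

lemma det_rowf_good {V : Type*} [Fintype V] [DecidableEq V] (r : V) (f : V → V)
    (hf : Good r f) : det (Matrix.of fun i => rowf r i (f i)) = 1 := by
  classical
  let dep : V → ℕ := fun i => Nat.find (hf i)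
  have hdep : ∀ i, i ≠ r → dep (f i) < dep i := by
    intro i hi
    have h := Nat.find_spec (hf i)
    change f^[dep i] i = r at h
    cases hk : dep i with
    | zero => rw [hk] at h; exact absurd h hi
    | succ k =>
      rw [hk] at h
      exact Nat.lt_succ_of_le (Nat.find_min' (hf (f i)) (by simpa using h))
  have hdr : dep r = 0 := by
    have := Nat.find_min' (hf r) (m := 0) rfl
    simpa [dep] using this
  let e : V → ℕᵒᵈ := fun i => OrderDual.toDual (dep i)
  have hB : BlockTriangular (Matrix.of fun i => rowf r i (f i)) e := by
    intro i j hij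
    have hij' : dep i < dep j := hij
    have h1 : j ≠ i := by rintro rfl; exact lt_irrefl _ hij'
    by_cases hi : i = r
    · subst hi
      simp [rowf, h1]
    · have h2 : j ≠ f i := by
        rintro rfl
        exact absurd (hdep i hi) (by omega)
      simp [rowf, hi, h1, h2]
  rw [hB.det]
  refine Finset.prod_eq_one fun a _ => ?_
  suffices hs : toSquareBlock (Matrix.of fun i => rowf r i (f i)) e a = 1 by
    rw [hs, Matrix.det_one]
  ext ⟨i, hi⟩ ⟨j, hj⟩
  simp only [toSquareBlock, toSquareBlockProp, of_apply, Matrix.one_apply, Subtype.mk.injEq]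
  have hij : dep i = dep j := by
    have : e i = e j := by rw [hi, hj]
    exact this
  by_cases hir : i = r
  · subst hir
    simp [rowf, Pi.single_apply, eq_comm]
  · have h2 : j ≠ f i := by
      rintro rfl
      exact absurd (hdep i hir) (by omega)
    by_cases hijj : i = j
    · subst hijj
      simp [rowf, hir, h2]
    · simp [rowf, hir, h2, hijj, Ne.symm hijj]

/-- Graph of a function. -/
def fgraph {V : Type*} (r : V) (f : V → V) : SimpleGraph V :=
  SimpleGraph.fromRel (fun i j => i ≠ r ∧ f i = j)

lemma fgraph_connected {V : Type*} (r : V) (f : V → V) (hf : Good r f) :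
    (fgraph r f).Connected := by
  have key : ∀ k : ℕ, ∀ i, f^[k] i = r → (fgraph r f).Reachable i r := by
    intro k
    induction k with
    | zero => intro i hi; simp only [Function.iterate_zero, id] at hi; rw [hi]
    | succ k ih =>
      intro i hi
      have h1 := ih (f i) (by simpa using hi)
      by_cases hir : i = r
      · rw [hir]
      by_cases hfi : i = f i
      · rw [← hfi] at h1; exact h1
      · have : (fgraph r f).Adj i (f i) := by
          simp [fgraph, hir]; exact hfi
        exact this.reachable.trans h1
  have : Nonempty V := ⟨r⟩
  refine ⟨fun i j => ?_⟩
  obtain ⟨k, hk⟩ := hf i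
  obtain ⟨l, hl⟩ := hf j
  exact (key k i hk).trans (key l j hl).symm

lemma fgraph_isTree {V : Type*} [Fintype V] (r : V) (f : V → V) (hf : Good r f) :
    (fgraph r f).IsTree := by
  classical
  have hc := fgraph_connected r f hf
  rw [isTree_iff_connected_and_card]
  refine ⟨hc, le_antisymm ?_ hc.card_vert_le_card_edgeSet_add_one⟩
  have hsub : (fgraph r f).edgeSet ⊆
      (((Finset.univ.erase r).image (fun i => s(i, f i)) : Finset (Sym2 V)) : Set (Sym2 V)) := by
    intro e
    induction e with
    | h a b =>
      intro h
      rw [SimpleGraph.mem_edgeSet] at h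
      simp only [fgraph, fromRel_adj] at h
      simp only [Finset.coe_image, Set.mem_image]
      rcases h.2 with ⟨h1, h2⟩ | ⟨h1, h2⟩
      · exact ⟨a, by simpa using h1, by rw [h2]⟩
      · exact ⟨b, by simpa using h1, by rw [h2, Sym2.eq_swap]⟩
  have h1 : Nat.card (fgraph r f).edgeSet ≤ (Finset.univ.erase r).card := by
    rw [Nat.card_coe_set_eq]
    refine (Set.ncard_le_ncard hsub (Finset.finite_toSet _)).trans ?_
    rw [Set.ncard_coe_finset]
    exact Finset.card_image_le
  rw [Finset.card_erase_of_mem (Finset.mem_univ r), Finset.card_univ] at h1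
  have : 0 < Fintype.card V := Fintype.card_pos_iff.2 ⟨r⟩
  rw [Nat.card_eq_fintype_card (α := V)]
  omega

lemma fgraph_inj {V : Type*} (r : V) (f g : V → V) (hf : Good r f)
    (hfr : f r = r) (hgr : g r = r) (hfne : ∀ i, i ≠ r → f i ≠ i)
    (h : fgraph r f = fgraph r g) : f = g := by
  have key : ∀ k : ℕ, ∀ i, f^[k] i = r → f i = g i := by
    intro k
    induction k with
    | zero => intro i hi; simp only [Function.iterate_zero, id] at hi; rw [hi, hfr, hgr]
    | succ k ih =>
      intro i hi
      have h1 := ih (f i) (by simpa using hi)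
      by_cases hir : i = r
      · rw [hir, hfr, hgr]
      by_contra hne
      have hadj : (fgraph r f).Adj i (f i) := by
        simp [fgraph, hir]; exact fun hh => hfne i hir hh.symm
      rw [h] at hadj
      simp only [fgraph, fromRel_adj] at hadj
      rcases hadj.2 with ⟨_, h2⟩ | ⟨h2, h3⟩
      · exact hne h2.symm
      · rw [h3] at h1
        -- f (f i) = i
        obtain ⟨l, hl⟩ := hf i
        have : ∀ l : ℕ, f^[l] i = i ∨ f^[l] i = f i := by
          intro l
          induction l with
          | zero => left; rfl
          | succ l ihl =>
            rw [Function.iterate_succ_apply']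
            rcases ihl with h | h <;> rw [h]
            · right; rfl
            · left; exact h1
        rcases this l with h | h
        · exact hir (h.symm.trans hl)
        · exact h2 (h.symm.trans hl)
  funext i
  obtain ⟨k, hk⟩ := hf i
  exact key k i hk

lemma exists_parent {V : Type*} (T : SimpleGraph V) (hT : T.IsTree) (r : V) :
    ∃ f : V → V, f r = r ∧ (∀ i, i ≠ r → T.Adj i (f i)) ∧ Good r f := by
  classical
  have hex : ∀ i, i ≠ r → ∃ j, T.Adj i j ∧ T.dist j r + 1 = T.dist i r := by
    intro i hi
    obtain ⟨p, hp⟩ := hT.connected.exists_walk_length_eq_dist i r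
    cases p with
    | nil => exact absurd rfl hi
    | cons hadj q =>
      refine ⟨_, hadj, ?_⟩
      rw [Walk.length_cons] at hp
      have h1 := SimpleGraph.dist_le q
      have h2 := hT.connected.dist_triangle (u := i) (v := _) (w := r) |>.trans
        (Nat.add_le_add_right (le_of_eq (SimpleGraph.dist_eq_one_iff_adj.2 hadj)) _)
      omega
  choose! p hp1 hp2 using hex
  refine ⟨fun i => if i = r then r else p i, by simp, ?_, ?_⟩
  · intro i hi
    simpa [hi] using hp1 i hi
  · have : ∀ k : ℕ, ∀ i, T.dist i r = k → (fun i => if i = r then r else p i)^[k] i = r := by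
      intro k
      induction k with
      | zero =>
        intro i hi
        exact (hT.connected.dist_eq_zero_iff).1 hi
      | succ k ih =>
        intro i hi
        have hir : i ≠ r := by rintro rfl; simp at hi
        rw [Function.iterate_succ_apply]
        apply ih
        simp only [hir, if_false]
        have := hp2 i hir
        omega
    intro i
    exact ⟨_, this _ i rfl⟩

lemma matrix_tree {V : Type*} [Fintype V] [DecidableEq V] (G : SimpleGraph V)
    [DecidableRel G.Adj] (r : V) :
    det (Matrix.of fun i => if i = r then (Pi.single r 1 : V → ℂ) else
      (Matrix.diagonal (fun k => (G.degree k : ℂ)) - G.adjMatrix ℂ) i)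
      = (numSpanningTrees G : ℂ) := by
  classical
  let A : V → Finset V := fun i => if i = r then {r} else G.neighborFinset i
  have hrow : (Matrix.of fun i => if i = r then (Pi.single r 1 : V → ℂ) else
      (Matrix.diagonal (fun k => (G.degree k : ℂ)) - G.adjMatrix ℂ) i)
      = fun i => ∑ j ∈ A i, rowf r i j := by
    ext i j
    by_cases hi : i = r
    · subst hi
      simp [A, rowf]
    · simp only [A, rowf, hi, if_false, Matrix.of_apply, Finset.sum_sub_distrib,
        Pi.sub_apply, Finset.sum_const, Finset.sum_apply, Pi.smul_apply, Matrix.sub_apply,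
        card_neighborFinset_eq_degree]
      simp [Matrix.diagonal_apply, Pi.single_apply, eq_comm]
  rw [hrow]
  have := (detRowAlternating (n := V) (R := ℂ)).toMultilinearMap.map_sum_finset
    (fun i j => rowf r i j) A
  have h2 : det (fun i => ∑ j ∈ A i, rowf r i j)
      = ∑ f ∈ Fintype.piFinset A, det (Matrix.of fun i => rowf r i (f i)) := this
  rw [h2]
  have hA : ∀ f ∈ Fintype.piFinset A, f r = r ∧ ∀ i, i ≠ r → G.Adj i (f i) := by
    intro f hf
    rw [Fintype.mem_piFinset] at hf
    refine ⟨by simpa [A] using hf r, fun i hi => by simpa [A, hi] using hf i⟩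
  have h3 : ∀ f ∈ Fintype.piFinset A, det (Matrix.of fun i => rowf r i (f i))
      = if Good r f then 1 else 0 := by
    intro f hf
    split_ifs with h
    · exact det_rowf_good r f h
    · exact det_rowf_bad r f (hA f hf).1 h
  rw [Finset.sum_congr rfl h3, Finset.sum_boole]
  congr 1
  unfold numSpanningTrees
  rw [← Fintype.card_coe, ← Nat.card_eq_fintype_card]
  let Φ : {f // f ∈ (Fintype.piFinset A).filter (Good r)} →
      {T : SimpleGraph V // T ≤ G ∧ T.IsTree} := fun f =>
    ⟨fgraph r f.1, by
      have hf := Finset.mem_filter.1 f.2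
      refine ⟨?_, fgraph_isTree r f.1 hf.2⟩
      intro a b hab
      simp only [fgraph, fromRel_adj] at hab
      rcases hab.2 with ⟨h1, h2⟩ | ⟨h1, h2⟩
      · rw [← h2]; exact (hA _ hf.1).2 a h1
      · rw [← h2]; exact ((hA _ hf.1).2 b h1).symm⟩
  refine Nat.card_eq_of_bijective Φ ⟨?_, ?_⟩
  · intro f g hfg
    have hf := Finset.mem_filter.1 f.2
    have hg := Finset.mem_filter.1 g.2
    refine Subtype.ext (fgraph_inj r f.1 g.1 hf.2 (hA _ hf.1).1 (hA _ hg.1).1 ?_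
      (congrArg Subtype.val hfg))
    intro i hi
    exact ((hA _ hf.1).2 i hi).ne'
  · rintro ⟨T, hTG, hT⟩
    obtain ⟨f, hfr, hfa, hgood⟩ := exists_parent T hT r
    refine ⟨⟨f, ?_⟩, ?_⟩
    · rw [Finset.mem_filter, Fintype.mem_piFinset]
      refine ⟨fun i => ?_, hgood⟩
      by_cases hi : i = r
      · subst hi; simp [A, hfr]
      · simpa [A, hi] using hTG (hfa i hi)
    · apply Subtype.ext
      have hle : fgraph r f ≤ T := by
        intro a b hab
        simp only [fgraph, fromRel_adj] at hab
        rcases hab.2 with ⟨h1, h2⟩ | ⟨h1, h2⟩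
        · rw [← h2]; exact hfa a h1
        · rw [← h2]; exact (hfa b h1).symm
      exact le_antisymm hle
        ((isTree_iff_minimal_connected.1 hT).2 (fgraph_connected r f hgood) hle)

end LHaux

namespace LHaux

open Matrix

/-- Principal minor of `L`, rows in `S` replaced by identity rows. -/
noncomputable def pm {V : Type*} [Fintype V] [DecidableEq V] (L : Matrix V V ℂ)
    (S : Finset V) : ℂ :=
  det (Matrix.of fun i => if i ∈ S then (1 : Matrix V V ℂ) i else L i)

lemma det_smul_add_diagonal {V : Type*} [Fintype V] [DecidableEq V] (L : Matrix V V ℂ)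
    (t : ℂ) (y : V → ℂ) :
    det (t • L + Matrix.diagonal y) =
      ∑ S : Finset V, (∏ i ∈ S, y i) * t ^ (Fintype.card V - S.card) * pm L S := by
  have h := (detRowAlternating (n := V) (R := ℂ)).toMultilinearMap.map_add_univ
    (fun i => (Matrix.diagonal y) i) (fun i => (t • L) i)
  have h2 : det (t • L + Matrix.diagonal y) = ∑ S : Finset V,
    det (S.piecewise (fun i => (Matrix.diagonal y) i) (fun i => (t • L) i)) := by
    rw [add_comm]; exact h
  rw [h2]
  refine Finset.sum_congr rfl fun S _ => ?_
  have h3 : (S.piecewise (fun i => (Matrix.diagonal y) i) (fun i => (t • L) i) : Matrix V V ℂ)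
      = Matrix.of fun i j => (if i ∈ S then y i else t) *
        (Matrix.of fun i => if i ∈ S then (1 : Matrix V V ℂ) i else L i : Matrix V V ℂ) i j := by
    ext i j
    by_cases hi : i ∈ S
    · simp [hi, Matrix.diagonal_apply, Matrix.one_apply]
    · simp [hi]
  rw [h3, Matrix.det_mul_column]
  unfold pm
  congr 1
  rw [Finset.prod_ite]
  congr 1
  · simp
  · rw [Finset.prod_const]
    congr 1
    rw [← Finset.card_compl]
    congr 1
    ext; simp

lemma pm_pair {V : Type*} [Fintype V] [DecidableEq V] (L : Matrix V V ℂ) (i j : V) :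
    pm L {i, j} = detMinor2 L i j := by
  have h := Matrix.det_piecewise_one_eq_submatrix_det L ({i, j} : Finset V)ᶜ
  have h1 : pm L {i, j} = det (Matrix.of <| (({i, j} : Finset V)ᶜ).piecewise L.row
      (1 : Matrix V V ℂ).row) := by
    unfold pm
    congr 1
    ext a b
    by_cases ha : a ∈ ({i, j} : Finset V)
    · have : a ∉ ({i, j} : Finset V)ᶜ := by rw [Finset.mem_compl, not_not]; exact ha
      simp only [Matrix.of_apply, ha, if_true, Finset.piecewise, this, if_false]
      rfl
    · have : a ∈ ({i, j} : Finset V)ᶜ := by rw [Finset.mem_compl]; exact ha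
      simp only [Matrix.of_apply, ha, Finset.piecewise, this, if_true, if_false]
      rfl
  rw [h1, h]
  unfold detMinor2
  rw [← Matrix.det_submatrix_equiv_self (Equiv.subtypeEquivRight
    (p := fun k => k ≠ i ∧ k ≠ j) (q := fun k => k ∈ ({i, j} : Finset V)ᶜ) (by intro x; simp))]
  rfl

lemma pm_singleton {V : Type*} [Fintype V] [DecidableEq V] (G : SimpleGraph V)
    [DecidableRel G.Adj] (r : V) :
    pm (Matrix.diagonal (fun k => (G.degree k : ℂ)) - G.adjMatrix ℂ) {r} =
      (numSpanningTrees G : ℂ) := by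
  rw [← matrix_tree G r]
  unfold pm
  congr 1
  ext i j
  by_cases hi : i = r
  · subst hi
    simp [Matrix.one_apply, Pi.single_apply, eq_comm]
  · simp [hi]

lemma pm_empty {V : Type*} [Fintype V] [DecidableEq V] [Nonempty V] (G : SimpleGraph V)
    [DecidableRel G.Adj] :
    pm (Matrix.diagonal (fun k => (G.degree k : ℂ)) - G.adjMatrix ℂ) ∅ = 0 := by
  have : pm (Matrix.diagonal (fun k => (G.degree k : ℂ)) - G.adjMatrix ℂ) ∅
      = det (G.lapMatrix ℂ) := by
    unfold pm
    congr 1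
  rw [this, ← Matrix.exists_mulVec_eq_zero_iff]
  refine ⟨fun _ => 1, ?_, G.lapMatrix_mulVec_const_eq_zero⟩
  intro h
  have := congrFun h (Classical.arbitrary V)
  simp at this

lemma sum_finset_split {n : ℕ} (g : Finset (Fin n) → ℂ) :
    ∑ S, g S = g ∅ + ∑ i, g {i} + ∑ i, ∑ j ∈ Finset.Ioi i, g {i, j}
      + ∑ S ∈ Finset.univ.filter (fun S : Finset (Fin n) => 3 ≤ S.card), g S := by
  have h1 : ∑ S, g S = ∑ S ∈ Finset.powersetCard 0 Finset.univ, g S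
      + ∑ S ∈ Finset.powersetCard 1 Finset.univ, g S
      + ∑ S ∈ Finset.powersetCard 2 Finset.univ, g S
      + ∑ S ∈ Finset.univ.filter (fun S : Finset (Fin n) => 3 ≤ S.card), g S := by
    have hk : ∀ k : ℕ, Finset.powersetCard k (Finset.univ : Finset (Fin n))
        = Finset.univ.filter (fun S : Finset (Fin n) => S.card = k) := by
      intro k; ext S; simp
    simp only [hk, Finset.sum_filter, ← Finset.sum_add_distrib]
    refine Finset.sum_congr rfl fun S _ => ?_
    rcases (by omega : S.card = 0 ∨ S.card = 1 ∨ S.card = 2 ∨ 3 ≤ S.card) with h | h | h | h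
    · simp [h]
    · simp [h]
    · simp [h]
    · have a0 : S.card ≠ 0 := by omega
      have a1 : S.card ≠ 1 := by omega
      have a2 : S.card ≠ 2 := by omega
      simp only [a0, a1, a2, h, if_true, if_false, zero_add]
  rw [h1]
  congr 2
  · rw [Finset.powersetCard_zero, Finset.powersetCard_one]
    simp
  · rw [Finset.sum_sigma']
    symm
    refine Finset.sum_bij (fun p _ => {p.1, p.2}) ?_ ?_ ?_ ?_
    · rintro ⟨i, j⟩ h
      simp only [Finset.mem_sigma, Finset.mem_univ, true_and, Finset.mem_Ioi] at h
      simp [Finset.mem_powersetCard, Finset.card_pair h.ne]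
    · rintro ⟨i, j⟩ h ⟨k, l⟩ h' heq
      simp only [Finset.mem_sigma, Finset.mem_univ, true_and, Finset.mem_Ioi] at h h'
      have hi : i ∈ ({k, l} : Finset (Fin n)) := by rw [← heq]; simp
      have hj : j ∈ ({k, l} : Finset (Fin n)) := by rw [← heq]; simp
      simp only [Finset.mem_insert, Finset.mem_singleton] at hi hj
      have : i = k ∧ j = l := by
        rcases hi with rfl | rfl <;> rcases hj with rfl | rfl
        · exact absurd h (lt_irrefl _)
        · exact ⟨rfl, rfl⟩
        · exact absurd h (lt_asymm h')
        · exact absurd h (lt_irrefl _)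
      obtain ⟨rfl, rfl⟩ := this
      rfl
    · intro S hS
      rw [Finset.mem_powersetCard] at hS
      obtain ⟨a, b, hab, rfl⟩ := Finset.card_eq_two.1 hS.2
      rcases lt_or_gt_of_ne hab with h | h
      · exact ⟨⟨a, b⟩, by simpa using h, rfl⟩
      · exact ⟨⟨b, a⟩, by simpa using h, Finset.pair_comm _ _⟩
    · rintro ⟨i, j⟩ _
      rfl

lemma FLH_expand {n : ℕ} (G : SimpleGraph (Fin n)) [DecidableRel G.Adj] (hG : G.Connected) :
    ∃ H : ℂ × ℂ → ℂ, ContDiff ℂ 2 H ∧ ∀ v s : ℂ, FLH G v s =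
      ((1 - v) * s - 1) * ((numSpanningTrees G : ℂ) * s ^ (n - 1) *
          ∑ i, (s * (G.degree i : ℂ) - 2))
      + ((1 - v) * s - 1) ^ 2 * (-(n * (numSpanningTrees G : ℂ) * s ^ (n - 1)) +
          s ^ (n - 2) * ∑ i, ∑ j ∈ Finset.Ioi i,
            (s * (G.degree i : ℂ) - 2) * (s * (G.degree j : ℂ) - 2) *
            detMinor2 (Matrix.diagonal (fun k => (G.degree k : ℂ)) - G.adjMatrix ℂ) i j)
      + ((1 - v) * s - 1) ^ 3 * H (v, s) := by
  have : Nonempty (Fin n) := hG.nonempty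
  set L := (Matrix.diagonal (fun k => (G.degree k : ℂ)) - G.adjMatrix ℂ) with hL
  refine ⟨fun p => p.2 ^ (n - 2) * (∑ i, ∑ j ∈ Finset.Ioi i,
      (((1 - p.1) * p.2 - 1) - (p.2 * (G.degree i : ℂ) - 2) - (p.2 * (G.degree j : ℂ) - 2)) *
        detMinor2 L i j)
    + ∑ S ∈ Finset.univ.filter (fun S : Finset (Fin n) => 3 ≤ S.card),
      ((1 - p.1) * p.2 - 1) ^ (S.card - 3) *
      (∏ i ∈ S, (p.2 * (G.degree i : ℂ) - 2 - ((1 - p.1) * p.2 - 1))) *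
        p.2 ^ (n - S.card) * pm L S, ?_, ?_⟩
  · fun_prop
  · intro v s
    set σ := (1 - v) * s - 1 with hσ
    have h1 : FLH G v s = det (s • L + Matrix.diagonal
        (fun i => σ * (s * (G.degree i : ℂ) - 2 - σ))) := by
      unfold FLH
      congr 1
      ext i j
      by_cases hij : i = j
      · subst hij
        simp [hL, hσ]
        ring
      · simp [hL, hij]
    rw [h1, det_smul_add_diagonal, sum_finset_split]
    simp only [hL, pm_empty, pm_singleton]
    rw [← hL]
    have h2 : ∀ i : Fin n, ∀ j ∈ Finset.Ioi i,
        (∏ k ∈ ({i, j} : Finset (Fin n)), σ * (s * (G.degree k : ℂ) - 2 - σ)) *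
          s ^ (Fintype.card (Fin n) - ({i, j} : Finset (Fin n)).card) * pm L {i, j}
        = σ ^ 2 * s ^ (n - 2) * ((s * (G.degree i : ℂ) - 2) * (s * (G.degree j : ℂ) - 2) *
            detMinor2 L i j) + σ ^ 3 * s ^ (n - 2) *
            ((σ - (s * (G.degree i : ℂ) - 2) - (s * (G.degree j : ℂ) - 2)) *
              detMinor2 L i j) := by
      intro i j hj
      have hne : i ≠ j := (Finset.mem_Ioi.1 hj).ne
      rw [Finset.prod_pair hne, Finset.card_pair hne, pm_pair, Fintype.card_fin]
      ring
    rw [Finset.sum_congr rfl fun i _ => Finset.sum_congr rfl (h2 i)]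
    have h3 : ∀ S ∈ Finset.univ.filter (fun S : Finset (Fin n) => 3 ≤ S.card),
        (∏ k ∈ S, σ * (s * (G.degree k : ℂ) - 2 - σ)) *
          s ^ (Fintype.card (Fin n) - S.card) * pm L S
        = σ ^ 3 * (σ ^ (S.card - 3) * (∏ i ∈ S, (s * (G.degree i : ℂ) - 2 - σ)) *
            s ^ (n - S.card) * pm L S) := by
      intro S hS
      have hc := (Finset.mem_filter.1 hS).2
      rw [Finset.prod_mul_distrib, Finset.prod_const, Fintype.card_fin]
      have : σ ^ S.card = σ ^ 3 * σ ^ (S.card - 3) := by rw [← pow_add]; congr 1; omega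
      rw [this]; ring
    rw [Finset.sum_congr rfl h3]
    simp only [Finset.sum_add_distrib, ← Finset.mul_sum, Finset.prod_singleton,
      Finset.card_singleton, Fintype.card_fin, ← Finset.sum_mul, Finset.sum_sub_distrib,
      Finset.sum_const, Finset.card_univ, nsmul_eq_mul]
    ring

end LHaux

namespace LHaux

lemma second_deriv (P Q H : ℂ → ℂ) (hP : ContDiff ℂ 2 P) (hQ : ContDiff ℂ 2 Q)
    (hH : ContDiff ℂ 2 H) (a b x₀ : ℂ) (h0 : a * x₀ + b = 0) (f : ℂ → ℂ)
    (hf : ∀ x, f x = (a * x + b) * P x + (a * x + b) ^ 2 * Q x + (a * x + b) ^ 3 * H x) :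
    deriv (deriv f) x₀ = 2 * a * deriv P x₀ + 2 * a ^ 2 * Q x₀ := by
  have d1 : ∀ {R : ℂ → ℂ}, ContDiff ℂ 2 R → ∀ x, HasDerivAt R (deriv R x) x := by
    intro R hR x
    exact (hR.differentiable (by norm_num) x).hasDerivAt
  have d2 : ∀ {R : ℂ → ℂ}, ContDiff ℂ 2 R → ∀ x, HasDerivAt (deriv R) (deriv (deriv R) x) x := by
    intro R hR x
    have : ContDiff ℂ 1 (deriv R) := by
      have hR' : ContDiff ℂ (1 + 1) R := by simpa [one_add_one_eq_two] using hR
      exact (contDiff_succ_iff_deriv.1 hR').2.2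
    exact (this.differentiable (by norm_num) x).hasDerivAt
  have hs : ∀ x, HasDerivAt (fun x => a * x + b) a x := by
    intro x
    simpa using ((hasDerivAt_id x).const_mul a).add_const b
  have hf1 : deriv f = fun x => (a * P x + (a * x + b) * deriv P x)
      + (2 * (a * x + b) * a * Q x + (a * x + b) ^ 2 * deriv Q x)
      + (3 * (a * x + b) ^ 2 * a * H x + (a * x + b) ^ 3 * deriv H x) := by
    funext x
    rw [show f = fun x => (a * x + b) * P x + (a * x + b) ^ 2 * Q x + (a * x + b) ^ 3 * H x from
      funext hf]
    have := ((((hs x).mul (d1 hP x)).add (((hs x).pow 2).mul (d1 hQ x))).add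
      (((hs x).pow 3).mul (d1 hH x))).deriv
    refine Eq.trans this ?_
    simp
  rw [hf1]
  have e1 := ((d1 hP x₀).const_mul a).add ((hs x₀).mul (d2 hP x₀))
  have e2 := (((((hs x₀).const_mul 2).mul_const a).mul (d1 hQ x₀))).add
    (((hs x₀).pow 2).mul (d2 hQ x₀))
  have e3 := ((((((hs x₀).pow 2).const_mul 3).mul_const a).mul (d1 hH x₀))).add
    (((hs x₀).pow 3).mul (d2 hH x₀))
  refine ((e1.add e2).add e3).deriv.trans ?_
  simp [h0]
  ring

lemma mixed_deriv (P Q : ℂ → ℂ) (H : ℂ × ℂ → ℂ) (hP : ContDiff ℂ 2 P) (hQ : ContDiff ℂ 2 Q)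
    (hH : ContDiff ℂ 2 H) (t : ℂ) (ht : t ≠ 0) (f : ℂ → ℂ → ℂ)
    (hf : ∀ v s, f v s = ((1 - v) * s - 1) * P s + ((1 - v) * s - 1) ^ 2 * Q s
      + ((1 - v) * s - 1) ^ 3 * H (v, s)) :
    deriv (fun s => deriv (fun v => f v s) (1 - 1 / t)) t
      = - P t - t * deriv P t - 2 * Q t := by
  set v₀ := 1 - 1 / t with hv₀
  let K : ℂ → ℂ := fun s => fderiv ℂ H (v₀, s) (1, 0)
  have hK : Differentiable ℂ K := by
    have h1 : ContDiff ℂ 1 (fderiv ℂ H) := hH.fderiv_right (by norm_num)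
    have h2 := h1.differentiable (by norm_num)
    intro s
    have h3 : DifferentiableAt ℂ (fun s : ℂ => fderiv ℂ H (v₀, s)) s :=
      (h2 (v₀, s)).comp s (by fun_prop)
    exact h3.clm_apply (differentiableAt_const _)
  have hHv : ∀ s, HasDerivAt (fun v => H (v, s)) (K s) v₀ := by
    intro s
    have h1 := (hH.differentiable (by norm_num) (v₀, s)).hasFDerivAt
    have h2 : HasDerivAt (fun v : ℂ => (v, s)) ((1 : ℂ), (0 : ℂ)) v₀ :=
      (hasDerivAt_id v₀).prodMk (hasDerivAt_const v₀ s)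
    exact h1.comp_hasDerivAt v₀ h2
  have hs : ∀ s v, HasDerivAt (fun v : ℂ => (1 - v) * s - 1) (-s) v := by
    intro s v
    simpa using (((hasDerivAt_id v).const_sub 1).mul_const s).sub_const 1
  have hd : (fun s => deriv (fun v => f v s) v₀) = fun s => -s * P s
      + 2 * ((1 - v₀) * s - 1) * (-s) * Q s
      + (3 * ((1 - v₀) * s - 1) ^ 2 * (-s) * H (v₀, s) + ((1 - v₀) * s - 1) ^ 3 * K s) := by
    funext s
    rw [show (fun v => f v s) = fun v => ((1 - v) * s - 1) * P s + ((1 - v) * s - 1) ^ 2 * Q s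
      + ((1 - v) * s - 1) ^ 3 * H (v, s) from funext fun v => hf v s]
    have := ((((hs s v₀).mul_const (P s)).add (((hs s v₀).pow 2).mul_const (Q s))).add
      (((hs s v₀).pow 3).mul (hHv s))).deriv
    refine Eq.trans this ?_
    simp
  rw [hd]
  have d1 : ∀ {R : ℂ → ℂ}, ContDiff ℂ 2 R → ∀ x, HasDerivAt R (deriv R x) x := by
    intro R hR x
    exact (hR.differentiable (by norm_num) x).hasDerivAt
  have hH2 : HasDerivAt (fun s => H (v₀, s)) (deriv (fun s => H (v₀, s)) t) t :=
    d1 (hH.comp (by fun_prop)) t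
  have hσ : HasDerivAt (fun s : ℂ => (1 - v₀) * s - 1) (1 - v₀) t := by
    simpa using ((hasDerivAt_id t).const_mul (1 - v₀)).sub_const 1
  have hn : HasDerivAt (fun s : ℂ => -s) (-1) t := (hasDerivAt_id t).neg
  have e1 := hn.mul (d1 hP t)
  have e2 := ((hσ.const_mul 2).mul hn).mul (d1 hQ t)
  have e3 := ((((hσ.pow 2).const_mul 3).mul hn).mul hH2).add ((hσ.pow 3).mul (hK t).hasDerivAt)
  refine ((e1.add e2).add e3).deriv.trans ?_
  have h0 : (1 - v₀) * t - 1 = 0 := by rw [hv₀]; field_simp; ring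
  have h1 : (1 - v₀) * t = 1 := by linear_combination h0
  simp [h0]
  linear_combination (-2 * Q t) * h1

end LHaux

theorem stmt9 {n : ℕ} (G : SimpleGraph (Fin n)) [DecidableRel G.Adj]
    (hG : G.Connected) (m : ℕ) (hm : G.edgeFinset.card = m)
    (Kf Kfstar Kfplus : ℂ)
    (hKf : Kf = ∑ i : Fin n, ∑ j ∈ Finset.Ioi i,
      detMinor2 (Matrix.diagonal (fun k => (G.degree k : ℂ)) - G.adjMatrix ℂ) i j
        / (numSpanningTrees G : ℂ))
    (hKfstar : Kfstar = ∑ i : Fin n, ∑ j ∈ Finset.Ioi i,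
      (G.degree i : ℂ) * (G.degree j : ℂ) *
        (detMinor2 (Matrix.diagonal (fun k => (G.degree k : ℂ)) - G.adjMatrix ℂ) i j
          / (numSpanningTrees G : ℂ)))
    (hKfplus : Kfplus = ∑ i : Fin n, ∑ j ∈ Finset.Ioi i,
      ((G.degree i : ℂ) + (G.degree j : ℂ)) *
        (detMinor2 (Matrix.diagonal (fun k => (G.degree k : ℂ)) - G.adjMatrix ℂ) i j
          / (numSpanningTrees G : ℂ))) :
    ∀ t : ℂ, t ≠ 0 →
      deriv (deriv (fun s => FLH G (1 - 1/t) s)) t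
          = 2 * t ^ ((n : ℤ) - 4) * (numSpanningTrees G : ℂ) *
              ((Kfstar * t ^ 2 - 2 * Kfplus * t + 4 * Kf) + n * t * (2 * m * t - 2 * n + 1))
      ∧ deriv (fun s => deriv (fun v => FLH G v s) (1 - 1/t)) t
          = 2 * t ^ ((n : ℤ) - 2) * (numSpanningTrees G : ℂ) *
              (((n : ℂ) - m * t) * ((n : ℂ) + 1) * t - (Kfstar * t ^ 2 - 2 * Kfplus * t + 4 * Kf))
      ∧ deriv (deriv (fun v => FLH G v t)) (1 - 1/t)
          = 2 * t ^ (n : ℤ) * (numSpanningTrees G : ℂ) *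
              ((Kfstar * t ^ 2 - 2 * Kfplus * t + 4 * Kf) - n * t) := by
  intro t ht
  have hκ : (numSpanningTrees G : ℂ) ≠ 0 := by
    obtain ⟨T, hTG, hT⟩ := hG.exists_isTree_le
    have : Nonempty {T : SimpleGraph (Fin n) // T ≤ G ∧ T.IsTree} := ⟨⟨T, hTG, hT⟩⟩
    have h : numSpanningTrees G ≠ 0 := Nat.card_pos.ne'
    exact_mod_cast h
  obtain ⟨H, hH, hF⟩ := LHaux.FLH_expand G hG
  have hn : n ≠ 0 := by
    rintro rfl
    exact (hG.nonempty).elim fun x => x.elim0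
  have hdeg : ∑ i, (G.degree i : ℂ) = 2 * m := by
    have := G.sum_degrees_eq_twice_card_edges
    rw [hm] at this
    exact_mod_cast this
  set κ : ℂ := (numSpanningTrees G : ℂ) with hκdef
  set L := (Matrix.diagonal (fun k => (G.degree k : ℂ)) - G.adjMatrix ℂ) with hL
  set Z := Kfstar * t ^ 2 - 2 * Kfplus * t + 4 * Kf with hZ
  have hZsum : ∑ i, ∑ j ∈ Finset.Ioi i,
      (t * (G.degree i : ℂ) - 2) * (t * (G.degree j : ℂ) - 2) * detMinor2 L i j = κ * Z := by
    rw [hZ, hKf, hKfstar, hKfplus]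
    simp only [Finset.mul_sum, Finset.sum_mul, ← Finset.sum_add_distrib, ← Finset.sum_sub_distrib]
    refine Finset.sum_congr rfl fun i _ => Finset.sum_congr rfl fun j _ => ?_
    field_simp
    ring
  let P : ℂ → ℂ := fun s => κ * s ^ (n - 1) * (2 * m * s - 2 * n)
  let Q : ℂ → ℂ := fun s => -(n * κ * s ^ (n - 1)) + s ^ (n - 2) * ∑ i, ∑ j ∈ Finset.Ioi i,
      (s * (G.degree i : ℂ) - 2) * (s * (G.degree j : ℂ) - 2) * detMinor2 L i j
  have hF' : ∀ v s, FLH G v s = ((1 - v) * s - 1) * P s + ((1 - v) * s - 1) ^ 2 * Q s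
      + ((1 - v) * s - 1) ^ 3 * H (v, s) := by
    intro v s
    rw [hF v s, Finset.sum_sub_distrib, ← Finset.mul_sum, hdeg]
    simp only [P, Q, Finset.sum_const, Finset.card_univ, Fintype.card_fin, nsmul_eq_mul]
    ring
  have hPc : ContDiff ℂ 2 P := by fun_prop
  have hQc : ContDiff ℂ 2 Q := by fun_prop
  have hP1 : deriv P t = κ * (((n : ℂ) - 1) * (t ^ n / t ^ 2) * (2 * m * t - 2 * n)
      + t ^ n / t * (2 * m)) := by
    obtain ⟨k, rfl⟩ := Nat.exists_eq_succ_of_ne_zero hn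
    have e1 : HasDerivAt (fun s : ℂ => 2 * m * s - 2 * ((k + 1 : ℕ) : ℂ)) (2 * m) t := by
      simpa using ((hasDerivAt_id t).const_mul (2 * (m : ℂ))).sub_const (2 * ((k + 1 : ℕ) : ℂ))
    have e2 := (((hasDerivAt_pow k t).const_mul κ).mul e1).deriv
    refine Eq.trans e2 ?_
    cases k with
    | zero => simp; field_simp; simp
    | succ k =>
      simp only [Nat.succ_eq_add_one, Nat.add_sub_cancel]
      push_cast
      field_simp
      ring
  have hP0 : P t = κ * (t ^ n / t) * (2 * m * t - 2 * n) := by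
    obtain ⟨k, rfl⟩ := Nat.exists_eq_succ_of_ne_zero hn
    simp only [P, Nat.succ_eq_add_one, Nat.add_sub_cancel]
    field_simp
    ring
  have hQ0 : Q t = κ * (t ^ n / t ^ 2) * (Z - n * t) := by
    simp only [Q]
    by_cases h1 : n = 1
    · subst h1
      have hz : κ * Z = 0 := by
        rw [← hZsum]
        refine Finset.sum_eq_zero fun i _ => Finset.sum_eq_zero fun j hj => ?_
        exact absurd (Finset.mem_Ioi.1 hj) (by rw [Subsingleton.elim i j]; exact lt_irrefl _)
      have hz' : Z = 0 := (mul_eq_zero.1 hz).resolve_left hκ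
      rw [hZsum, hz']
      simp
      field_simp
    · obtain ⟨k, rfl⟩ : ∃ k, n = k + 2 := ⟨n - 2, by omega⟩
      rw [hZsum]
      simp only [show k + 2 - 1 = k + 1 by omega, show k + 2 - 2 = k by omega]
      field_simp
      ring
  have z4 : t ^ ((n : ℤ) - 4) = t ^ n / t ^ 4 := by
    rw [zpow_sub₀ ht]; norm_cast
  have z2 : t ^ ((n : ℤ) - 2) = t ^ n / t ^ 2 := by
    rw [zpow_sub₀ ht]; norm_cast
  have z0 : t ^ (n : ℤ) = t ^ n := by norm_cast
  rw [z4, z2, z0]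
  refine ⟨?_, ?_, ?_⟩
  · rw [LHaux.second_deriv P Q (fun s => H (1 - 1 / t, s)) hPc hQc (hH.comp (by fun_prop))
      (1 / t) (-1) t (by field_simp; ring) _ (fun s => by rw [hF']; ring), hP1, hQ0]
    field_simp
    ring
  · rw [LHaux.mixed_deriv P Q H hPc hQc hH t ht (FLH G) hF', hP0, hP1, hQ0]
    field_simp
    ring
  · rw [LHaux.second_deriv (fun _ => P t) (fun _ => Q t) (fun v => H (v, t)) contDiff_const
      contDiff_const (hH.comp (by fun_prop))
      (-t) (t - 1) (1 - 1 / t) (by field_simp; ring) _ (fun s => by rw [hF']; ring), hQ0]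
    simp
    field_simp
end
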